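/- Let $n\geq 2$ and $1\leq \ell<n$ be integers, let $0<\alpha<n$, $0<\sigma<\ell$, and $\ell(n-\ell)+\sigma-\alpha<\beta<\ell(n-\ell)$. Let $\lambda$ be a nonnegative Borel measure on the space of orthogonal projections of $\mathbb{R}^n$ onto $\ell$-dimensional linear subspaces (a subset of the bounded linear operators on $\mathbb{R}^n$ with the operator-norm metric) which is $\beta$-dimensional in the sense that there is a constant $c>0$ with $\lambda(B(P,r))\leq c\,r^{\beta}$ for every such projection $P$ and every $r>0$. Let $E\subset\mathbb{R}^n$ be a Borel set with Hausdorff dimension at least $\alpha$. Then for $\lambda$-almost every orthogonal projection $P$ onto an $\ell$-dimensional subspace, the image $P(E)$ has Hausdorff dimension at least $\sigma$. -/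

import Mathlib

open MeasureTheory Metric Set
open scoped InnerProductSpace ENNReal

/-- The half-open dyadic cube of side `2⁻ᵏ` with index `(k, a)`. -/
def dyadicCube {n : ℕ} (w : ℕ × (Fin n → ℤ)) : Set (EuclideanSpace ℝ (Fin n)) :=
  {x | ∀ i, ⌊(2 : ℝ) ^ w.1 * x i⌋ = w.2 i}

/-- The index of the dyadic cube of side `2⁻ᵏ` containing `x`. -/
noncomputable def dyadicIndex {n : ℕ} (k : ℕ) (x : EuclideanSpace ℝ (Fin n)) :
    ℕ × (Fin n → ℤ) := (k, fun i => ⌊(2 : ℝ) ^ k * x i⌋)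

theorem mem_dyadicCube_iff {n : ℕ} {w : ℕ × (Fin n → ℤ)} {x : EuclideanSpace ℝ (Fin n)} :
    x ∈ dyadicCube w ↔ dyadicIndex w.1 x = w := by
  simp [dyadicCube, dyadicIndex, Prod.ext_iff, funext_iff]

theorem mem_dyadicCube_dyadicIndex {n : ℕ} (k : ℕ) (x : EuclideanSpace ℝ (Fin n)) :
    x ∈ dyadicCube (dyadicIndex k x) := fun _ => rfl

theorem measurableSet_dyadicCube {n : ℕ} (w : ℕ × (Fin n → ℤ)) :
    MeasurableSet (dyadicCube w) := by
  have : dyadicCube w =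
      ⋂ i, (fun x : EuclideanSpace ℝ (Fin n) => ⌊(2 : ℝ) ^ w.1 * x i⌋) ⁻¹' {w.2 i} := by
    ext x; simp [dyadicCube]
  rw [this]
  refine MeasurableSet.iInter fun i => ?_
  have h : Measurable fun x : EuclideanSpace ℝ (Fin n) => ⌊(2 : ℝ) ^ w.1 * x i⌋ := by
    refine Int.measurable_floor.comp ?_
    fun_prop
  exact h (measurableSet_singleton _)

theorem dyadicCube_subset_of_mem {n : ℕ} {w w' : ℕ × (Fin n → ℤ)} {x : EuclideanSpace ℝ (Fin n)}
    (hx : x ∈ dyadicCube w) (hx' : x ∈ dyadicCube w') (h : w.1 ≤ w'.1) :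
    dyadicCube w' ⊆ dyadicCube w := by
  obtain ⟨d, hd⟩ := Nat.exists_eq_add_of_le h
  have key : ∀ t : ℝ, ⌊(2 : ℝ) ^ w.1 * t⌋ = ⌊(2 : ℝ) ^ w'.1 * t⌋ / (2 ^ d : ℕ) := by
    intro t
    rw [← Int.floor_div_natCast, hd]
    congr 1
    push_cast
    field_simp
    ring
  intro y hy i
  rw [key, hy i, ← hx' i, ← key, hx i]

/-- The measure on the index set of dyadic cubes giving mass `2⁻ᵏˢ` to cubes of side `2⁻ᵏ`. -/
noncomputable def dyadicWeight (n : ℕ) (s : ℝ) : Measure (ℕ × (Fin n → ℤ)) :=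
  Measure.sum fun w => ENNReal.ofReal ((2 : ℝ) ^ (-(s * w.1))) • Measure.dirac w

theorem dyadicWeight_apply {n : ℕ} {s : ℝ} (C : Set (ℕ × (Fin n → ℤ))) :
    dyadicWeight n s C =
      ∑' w, C.indicator (fun w => ENNReal.ofReal ((2 : ℝ) ^ (-(s * w.1)))) w := by
  rw [dyadicWeight, Measure.sum_apply _ (Set.to_countable C).measurableSet]
  refine tsum_congr fun w => ?_
  by_cases h : w ∈ C <;> simp [h]

theorem dyadicWeight_singleton {n : ℕ} {s : ℝ} (w : ℕ × (Fin n → ℤ)) :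
    dyadicWeight n s {w} = ENNReal.ofReal ((2 : ℝ) ^ (-(s * w.1))) := by
  rw [dyadicWeight_apply, tsum_eq_single w]
  · simp
  · intro b hb; simp [hb]

/-- The `s`-dimensional dyadic net content. -/
noncomputable def dyadicContent {n : ℕ} (s : ℝ) (A : Set (EuclideanSpace ℝ (Fin n))) : ℝ≥0∞ :=
  ⨅ (C : Set (ℕ × (Fin n → ℤ))) (_ : A ⊆ ⋃ w ∈ C, dyadicCube w), dyadicWeight n s C

theorem dyadicContent_le {n : ℕ} {s : ℝ} {A : Set (EuclideanSpace ℝ (Fin n))}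
    {C : Set (ℕ × (Fin n → ℤ))} (h : A ⊆ ⋃ w ∈ C, dyadicCube w) :
    dyadicContent s A ≤ dyadicWeight n s C := iInf₂_le C h

theorem dyadicContent_mono {n : ℕ} {s : ℝ} {A B : Set (EuclideanSpace ℝ (Fin n))} (h : A ⊆ B) :
    dyadicContent s A ≤ dyadicContent s B :=
  le_iInf₂ fun _ hC => dyadicContent_le (h.trans hC)

theorem dyadicContent_le_of_subset_dyadicCube {n : ℕ} {s : ℝ} {A : Set (EuclideanSpace ℝ (Fin n))}
    {w : ℕ × (Fin n → ℤ)} (h : A ⊆ dyadicCube w) :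
    dyadicContent s A ≤ ENNReal.ofReal ((2 : ℝ) ^ (-(s * w.1))) := by
  rw [← dyadicWeight_singleton]
  exact dyadicContent_le (by simpa using h)

theorem exists_cover_lt {n : ℕ} {s : ℝ} {A : Set (EuclideanSpace ℝ (Fin n))} {c : ℝ≥0∞}
    (h : dyadicContent s A < c) :
    ∃ C : Set (ℕ × (Fin n → ℤ)), A ⊆ ⋃ w ∈ C, dyadicCube w ∧ dyadicWeight n s C < c := by
  simpa [dyadicContent, iInf_lt_iff] using h

theorem dyadicContent_iUnion_le {n : ℕ} {s : ℝ} {ι : Type*} [Countable ι]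
    (A : ι → Set (EuclideanSpace ℝ (Fin n))) :
    dyadicContent s (⋃ i, A i) ≤ ∑' i, dyadicContent s (A i) := by
  refine ENNReal.le_of_forall_pos_le_add fun ε hε hfin => ?_
  obtain ⟨δ, hδ, hδs⟩ := ENNReal.exists_pos_sum_of_countable (ENNReal.coe_pos.2 hε).ne' ι
  have hlt : ∀ i, dyadicContent s (A i) < dyadicContent s (A i) + δ i := fun i =>
    ENNReal.lt_add_right ((ENNReal.le_tsum i).trans_lt hfin).ne (by simpa using (hδ i).ne')
  choose C hC hCw using fun i => exists_cover_lt (hlt i)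
  calc dyadicContent s (⋃ i, A i) ≤ dyadicWeight n s (⋃ i, C i) := by
        refine dyadicContent_le (iUnion_subset fun i x hx => ?_)
        obtain ⟨w, hw, hxw⟩ := mem_iUnion₂.1 (hC i hx)
        exact mem_iUnion₂.2 ⟨w, mem_iUnion.2 ⟨i, hw⟩, hxw⟩
    _ ≤ ∑' i, dyadicWeight n s (C i) := measure_iUnion_le _
    _ ≤ ∑' i, (dyadicContent s (A i) + δ i) := ENNReal.tsum_le_tsum fun i => (hCw i).le
    _ = ∑' i, dyadicContent s (A i) + ∑' i, (δ i : ℝ≥0∞) := ENNReal.tsum_add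
    _ ≤ _ := by gcongr

/-- The members of a family of dyadic cubes not strictly contained in another one. -/
def maximalCubes {n : ℕ} (C : Set (ℕ × (Fin n → ℤ))) : Set (ℕ × (Fin n → ℤ)) :=
  {w ∈ C | ∀ w' ∈ C, dyadicCube w ⊆ dyadicCube w' → w.1 ≤ w'.1}

theorem eq_of_mem_dyadicCube {n : ℕ} {w w' : ℕ × (Fin n → ℤ)} {x : EuclideanSpace ℝ (Fin n)}
    (hx : x ∈ dyadicCube w) (hx' : x ∈ dyadicCube w') (h : w.1 = w'.1) : w = w' := by
  rw [← mem_dyadicCube_iff.1 hx, ← mem_dyadicCube_iff.1 hx', h]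

/-- Every cube of the family is contained in a maximal one. -/
theorem exists_mem_maximalCubes {n : ℕ} {C : Set (ℕ × (Fin n → ℤ))}
    {w : ℕ × (Fin n → ℤ)} {x : EuclideanSpace ℝ (Fin n)} (hw : w ∈ C) (hx : x ∈ dyadicCube w) :
    ∃ w' ∈ maximalCubes C, x ∈ dyadicCube w' ∧ w'.1 ≤ w.1 := by
  classical
  have hex : ∃ k, ∃ w' ∈ C, x ∈ dyadicCube w' ∧ w'.1 = k := ⟨w.1, w, hw, hx, rfl⟩
  obtain ⟨w', hw', hxw', hk⟩ := Nat.find_spec hex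
  refine ⟨w', ⟨hw', fun v hv hsub => ?_⟩, hxw', ?_⟩
  · rw [hk]
    exact Nat.find_min' hex ⟨v, hv, hsub hxw', rfl⟩
  · rw [hk]
    exact Nat.find_min' hex ⟨w, hw, hx, rfl⟩

/-- Strong subadditivity of the weight with respect to taking maximal cubes. -/
theorem dyadicWeight_maximalCubes_union {n : ℕ} {s : ℝ} {A : Set (EuclideanSpace ℝ (Fin n))}
    {C D : Set (ℕ × (Fin n → ℤ))} (hC : A ⊆ ⋃ w ∈ C, dyadicCube w)
    (hD : A ⊆ ⋃ w ∈ D, dyadicCube w) :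
    dyadicContent s A + dyadicWeight n s (maximalCubes (C ∪ D)) ≤
      dyadicWeight n s C + dyadicWeight n s D := by
  set S := maximalCubes (C ∪ D)
  have hms : ∀ B : Set (ℕ × (Fin n → ℤ)), MeasurableSet B := fun B =>
    (Set.to_countable B).measurableSet
  have hcov : A ⊆ ⋃ w ∈ ((C ∪ D) \ S) ∪ (C ∩ D), dyadicCube w := by
    intro x hx
    obtain ⟨c, hc, hxc⟩ := mem_iUnion₂.1 (hC hx)
    obtain ⟨d, hd, hxd⟩ := mem_iUnion₂.1 (hD hx)
    rcases lt_trichotomy c.1 d.1 with h | h | h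
    · refine mem_iUnion₂.2 ⟨d, Or.inl ⟨Or.inr hd, fun hS => ?_⟩, hxd⟩
      exact absurd (hS.2 c (Or.inl hc) (dyadicCube_subset_of_mem hxc hxd h.le)) (by omega)
    · obtain rfl := eq_of_mem_dyadicCube hxc hxd h
      exact mem_iUnion₂.2 ⟨c, Or.inr ⟨hc, hd⟩, hxc⟩
    · refine mem_iUnion₂.2 ⟨c, Or.inl ⟨Or.inl hc, fun hS => ?_⟩, hxc⟩
      exact absurd (hS.2 d (Or.inr hd) (dyadicCube_subset_of_mem hxd hxc h.le)) (by omega)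
  have hS : S ⊆ C ∪ D := fun w hw => hw.1
  calc dyadicContent s A + dyadicWeight n s S
      ≤ (dyadicWeight n s ((C ∪ D) \ S) + dyadicWeight n s (C ∩ D)) + dyadicWeight n s S := by
        gcongr
        exact (dyadicContent_le hcov).trans (measure_union_le _ _)
    _ = (dyadicWeight n s ((C ∪ D) ∩ S) + dyadicWeight n s ((C ∪ D) \ S))
          + dyadicWeight n s (C ∩ D) := by
        rw [inter_eq_right.2 hS]; ring
    _ = dyadicWeight n s C + dyadicWeight n s D := by
        rw [measure_inter_add_sdiff _ (hms S), measure_union_add_inter _ (hms D)]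

/-- The increasing sets lemma for dyadic net contents. -/
theorem dyadicContent_iUnion_le_of_monotone {n : ℕ} {s : ℝ}
    {A : ℕ → Set (EuclideanSpace ℝ (Fin n))} (hA : Monotone A) {a : ℝ≥0∞} (ha : a ≠ ∞)
    (h : ∀ N, dyadicContent s (A N) ≤ a) : dyadicContent s (⋃ N, A N) ≤ a := by
  refine ENNReal.le_of_forall_pos_le_add fun ε hε _ => ?_
  obtain ⟨δ, hδ, hδs⟩ := ENNReal.exists_pos_sum_of_countable (ENNReal.coe_pos.2 hε).ne' ℕ
  have hlt : ∀ i, dyadicContent s (A i) < dyadicContent s (A i) + δ i := fun i =>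
    ENNReal.lt_add_right ((h i).trans_lt ha.lt_top).ne (by simpa using (hδ i).ne')
  choose C hC hCw using fun i => exists_cover_lt (hlt i)
  obtain ⟨D, hD0, hDsucc⟩ : ∃ D : ℕ → Set (ℕ × (Fin n → ℤ)),
      D 0 = C 0 ∧ ∀ N, D (N + 1) = maximalCubes (D N ∪ C (N + 1)) :=
    ⟨fun N => Nat.rec (C 0) (fun N DN => maximalCubes (DN ∪ C (N + 1))) N, rfl, fun _ => rfl⟩
  have hstep : ∀ N, ∀ x w, w ∈ D N → x ∈ dyadicCube w →
      ∃ w' ∈ D (N + 1), x ∈ dyadicCube w' ∧ w'.1 ≤ w.1 := fun N x w hw hx => by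
    rw [hDsucc]
    exact exists_mem_maximalCubes (Or.inl hw) hx
  have hDcov : ∀ N, A N ⊆ ⋃ w ∈ D N, dyadicCube w := by
    intro N x hx
    cases N with
    | zero => rw [hD0]; exact hC 0 hx
    | succ N =>
      obtain ⟨c, hc, hxc⟩ := mem_iUnion₂.1 (hC _ hx)
      obtain ⟨w, hw, hxw, -⟩ := exists_mem_maximalCubes (C := D N ∪ C (N + 1)) (Or.inr hc) hxc
      rw [hDsucc]
      exact mem_iUnion₂.2 ⟨w, hw, hxw⟩
  have hDw : ∀ N, dyadicWeight n s (D N) ≤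
      dyadicContent s (A N) + ∑ i ∈ Finset.range (N + 1), (δ i : ℝ≥0∞) := by
    intro N
    induction N with
    | zero => simpa [hD0] using (hCw 0).le
    | succ N ih =>
      have h1 := dyadicWeight_maximalCubes_union (s := s) (hDcov N)
        ((hA (Nat.le_succ N)).trans (hC (N + 1)))
      rw [← hDsucc] at h1
      refine (ENNReal.add_le_add_iff_left ((h N).trans_lt ha.lt_top).ne).1 (h1.trans ?_)
      calc _ ≤ (dyadicContent s (A N) + ∑ i ∈ Finset.range (N + 1), (δ i : ℝ≥0∞)) +
            (dyadicContent s (A (N + 1)) + δ (N + 1)) := add_le_add ih (hCw _).le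
        _ = _ := by rw [Finset.sum_range_succ _ (N + 1)]; ring
  have hDa : ∀ N, dyadicWeight n s (D N) ≤ a + ε := fun N =>
    (hDw N).trans (add_le_add (h N) ((ENNReal.sum_le_tsum _).trans hδs.le))
  have hcov : (⋃ N, A N) ⊆ ⋃ w ∈ ⋃ N, ⋂ m ≥ N, D m, dyadicCube w := by
    intro x hx
    obtain ⟨N, hN⟩ := mem_iUnion.1 hx
    classical
    have hex : ∃ k, ∃ m ≥ N, dyadicIndex k x ∈ D m := by
      obtain ⟨w, hw, hxw⟩ := mem_iUnion₂.1 (hDcov N hN)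
      exact ⟨w.1, N, le_rfl, by rwa [mem_dyadicCube_iff.1 hxw]⟩
    obtain ⟨k, hk, hmin⟩ : ∃ k, (∃ m ≥ N, dyadicIndex k x ∈ D m) ∧
        ∀ j, (∃ m ≥ N, dyadicIndex j x ∈ D m) → k ≤ j :=
      ⟨sInf _, Nat.sInf_mem hex, fun j hj => Nat.sInf_le hj⟩
    obtain ⟨m, hm, hD⟩ := hk
    refine mem_iUnion₂.2 ⟨_, mem_iUnion.2 ⟨m, mem_iInter₂.2 fun p hp => ?_⟩,
      mem_dyadicCube_dyadicIndex k x⟩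
    induction p, hp using Nat.le_induction with
    | base => exact hD
    | succ p hp ih =>
      obtain ⟨w', hw', hxw', hle⟩ := hstep p x _ ih (mem_dyadicCube_dyadicIndex _ x)
      have : k ≤ w'.1 :=
        hmin _ ⟨p + 1, by omega, by rwa [mem_dyadicCube_iff.1 hxw']⟩
      have heq : w'.1 = k := le_antisymm hle this
      rwa [← heq, mem_dyadicCube_iff.1 hxw']
  refine (dyadicContent_le hcov).trans ?_
  have hmono : Monotone fun N => ⋂ m ≥ N, D m := fun N M hNM =>
    biInter_mono (fun m (hm : m ≥ M) => hNM.trans hm) fun _ _ => le_rfl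
  rw [hmono.measure_iUnion]
  exact iSup_le fun N => (measure_mono (biInter_subset_of_mem (le_refl N))).trans (hDa N)

theorem ENNReal.exists_le_tsum_eq {ι : Type*} {f : ι → ℝ≥0∞} (hf : ∀ i, f i ≠ ∞) {t : ℝ≥0∞}
    (ht : t ≤ ∑' i, f i) : ∃ g : ι → ℝ≥0∞, (∀ i, g i ≤ f i) ∧ ∑' i, g i = t := by
  classical
  rcases ht.eq_or_lt with rfl | ht
  · exact ⟨f, fun _ => le_rfl, rfl⟩
  rw [ENNReal.tsum_eq_iSup_sum, lt_iSup_iff] at ht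
  obtain ⟨S, hS⟩ := ht
  have hne : ∑ i ∈ S, f i ≠ 0 := (bot_le.trans_lt hS).ne'
  have hfin : ∑ i ∈ S, f i ≠ ∞ := by simp [ENNReal.sum_eq_top, hf]
  refine ⟨fun i => if i ∈ S then t / (∑ i ∈ S, f i) * f i else 0, fun i => ?_, ?_⟩
  · dsimp only
    split_ifs
    · calc _ ≤ 1 * f i := by gcongr; exact ENNReal.div_le_of_le_mul (by simpa using hS.le)
        _ = f i := one_mul _
    · exact zero_le
  · rw [tsum_eq_sum (s := S) (fun i hi => by simp [hi]), Finset.sum_ite_mem, Finset.inter_self,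
      ← Finset.mul_sum, ENNReal.div_mul_cancel hne hfin]

/-- Distributing the content of a set down `m` generations of dyadic cubes. -/
theorem exists_measure_dyadicCube_le {n : ℕ} {s : ℝ} (m : ℕ) :
    ∀ (k : ℕ) (A : Set (EuclideanSpace ℝ (Fin n))) (w : ℕ × (Fin n → ℤ)), w.1 = k →
      A ⊆ dyadicCube w → ∀ t ≤ dyadicContent s A,
      ∃ ν : Measure (EuclideanSpace ℝ (Fin n)), ν univ = t ∧ ν Aᶜ = 0 ∧
        ∀ v : ℕ × (Fin n → ℤ), k ≤ v.1 → v.1 ≤ k + m →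
          ν (dyadicCube v) ≤ ENNReal.ofReal ((2 : ℝ) ^ (-(s * v.1))) := by
  induction m with
  | zero =>
    intro k A w hw hA t ht
    rcases eq_or_ne t 0 with rfl | ht0
    · exact ⟨0, by simp, by simp, by simp⟩
    have hne : A.Nonempty := by
      by_contra h
      rw [not_nonempty_iff_eq_empty] at h
      subst h
      refine ht0 (le_bot_iff.1 (ht.trans ?_))
      have := dyadicContent_le (s := s) (A := (∅ : Set (EuclideanSpace ℝ (Fin n)))) (C := ∅)
        (by simp)
      simpa using this
    obtain ⟨x, hx⟩ := hne
    refine ⟨t • Measure.dirac x, by simp, ?_, fun v hv hv' => ?_⟩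
    · have : (Measure.dirac x) Aᶜ = 0 := by
        simp [Measure.dirac_apply, hx]
      simp [this]
    · have hvk : v.1 = w.1 := by omega
      calc _ ≤ (t • Measure.dirac x) univ := measure_mono (subset_univ _)
        _ = t := by simp
        _ ≤ _ := ht.trans (by rw [hvk]; exact dyadicContent_le_of_subset_dyadicCube hA)
  | succ m ih =>
    intro k A w hw hA t ht
    let ch : (Fin n → ℤ) → Set (EuclideanSpace ℝ (Fin n)) := fun a => A ∩ dyadicCube (k + 1, a)
    have hch : A ⊆ ⋃ a, ch a := fun x hx =>
      mem_iUnion.2 ⟨_, hx, mem_dyadicCube_dyadicIndex (k + 1) x⟩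
    have hle : t ≤ ∑' a, dyadicContent s (ch a) :=
      ht.trans ((dyadicContent_mono hch).trans (dyadicContent_iUnion_le _))
    obtain ⟨g, hg, rfl⟩ := ENNReal.exists_le_tsum_eq (fun a =>
      ((dyadicContent_le_of_subset_dyadicCube (s := s) (A := ch a)
        (w := (k + 1, a)) inter_subset_right).trans_lt ENNReal.ofReal_lt_top).ne) hle
    choose ν hν1 hν2 hν3 using fun a =>
      ih (k + 1) (ch a) (k + 1, a) rfl inter_subset_right (g a) (hg a)
    refine ⟨Measure.sum ν, by simp [hν1], ?_, fun v hv hv' => ?_⟩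
    · rw [Measure.sum_apply_eq_zero]
      exact fun a => measure_mono_null (compl_subset_compl.2 inter_subset_left) (hν2 a)
    · rcases hv.eq_or_lt with hvk | hvk
      · calc _ ≤ Measure.sum ν univ := measure_mono (subset_univ _)
          _ = ∑' a, g a := by simp [hν1]
          _ ≤ dyadicContent s A := ht
          _ ≤ _ := by rw [← hvk, ← hw]; exact dyadicContent_le_of_subset_dyadicCube hA
      · rw [Measure.sum_apply _ (measurableSet_dyadicCube v)]
        by_cases hne : ∃ x, x ∈ dyadicCube v
        · obtain ⟨x, hx⟩ := hne
          rw [tsum_eq_single (dyadicIndex (k + 1) x).2]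
          · exact hν3 _ v hvk (by omega)
          · intro a ha
            refine measure_mono_null ?_ (hν2 a)
            intro y hy hya
            have h1 := mem_dyadicCube_iff.1 hya.2
            have h2 := dyadicCube_subset_of_mem (mem_dyadicCube_dyadicIndex (k + 1) x) hx hvk hy
            rw [mem_dyadicCube_iff] at h2
            exact ha (by rw [← h2]; exact (congrArg Prod.snd h1).symm)
        · have : dyadicCube v = ∅ := by
            ext x; simpa using fun hx => hne ⟨x, hx⟩
          simp [this]

/-- The `3ⁿ` dyadic cubes of the same generation touching a given one. -/
noncomputable def neighborCubes {n : ℕ} (w : ℕ × (Fin n → ℤ)) : Finset (ℕ × (Fin n → ℤ)) :=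
  {w.1} ×ˢ Fintype.piFinset fun i => Finset.Icc (w.2 i - 1) (w.2 i + 1)

theorem card_neighborCubes {n : ℕ} (w : ℕ × (Fin n → ℤ)) : (neighborCubes w).card = 3 ^ n := by
  have : ∀ a : ℤ, (a + 1 + 1 - (a - 1)).toNat = 3 := fun a => by omega
  simp [neighborCubes, this]

theorem mem_neighborCubes {n : ℕ} {w v : ℕ × (Fin n → ℤ)} :
    v ∈ neighborCubes w ↔ v.1 = w.1 ∧ ∀ i, w.2 i - 1 ≤ v.2 i ∧ v.2 i ≤ w.2 i + 1 := by
  rw [neighborCubes, Finset.mem_product, Finset.mem_singleton, Fintype.mem_piFinset]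
  simp only [Finset.mem_Icc]

theorem dyadicContent_le_of_subset_neighborCubes {n : ℕ} {s : ℝ}
    {C : Set (ℕ × (Fin n → ℤ))} {A : Set (EuclideanSpace ℝ (Fin n))}
    (hA : A ⊆ ⋃ w ∈ C, ⋃ v ∈ neighborCubes w, dyadicCube v) :
    dyadicContent s A ≤ 3 ^ n * dyadicWeight n s C := by
  have hcov : A ⊆ ⋃ v ∈ ⋃ w ∈ C, (neighborCubes w : Set (ℕ × (Fin n → ℤ))), dyadicCube v := by
    intro x hx
    obtain ⟨w, hw, hx⟩ := mem_iUnion₂.1 (hA hx)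
    obtain ⟨v, hv, hxv⟩ := mem_iUnion₂.1 hx
    exact mem_iUnion₂.2 ⟨v, mem_iUnion₂.2 ⟨w, hw, hv⟩, hxv⟩
  refine (dyadicContent_le hcov).trans ?_
  have hw : ∀ w : ℕ × (Fin n → ℤ), dyadicWeight n s (neighborCubes w : Set (ℕ × (Fin n → ℤ))) =
      3 ^ n * dyadicWeight n s {w} := by
    intro w
    rw [← sum_measure_singleton, Finset.sum_congr rfl (g := fun _ => dyadicWeight n s {w}),
      Finset.sum_const, card_neighborCubes]
    · simp
    · intro v hv
      rw [dyadicWeight_singleton, dyadicWeight_singleton, (mem_neighborCubes.1 hv).1]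
  calc _ ≤ ∑' w : C, dyadicWeight n s (neighborCubes w.1 : Set (ℕ × (Fin n → ℤ))) :=
        measure_biUnion_le _ C.to_countable _
    _ = 3 ^ n * ∑' w : C, dyadicWeight n s {w.1} := by
        simp_rw [hw, ENNReal.tsum_mul_left]
    _ = 3 ^ n * dyadicWeight n s C := by
        congr 1
        rw [dyadicWeight_apply, ← tsum_subtype]
        simp_rw [dyadicWeight_singleton]

theorem exists_mem_neighborCubes {n : ℕ} {w : ℕ × (Fin n → ℤ)} {x y : EuclideanSpace ℝ (Fin n)}
    (hx : x ∈ dyadicCube w) (hy : dist y x < (2⁻¹ : ℝ) ^ w.1) :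
    ∃ v ∈ neighborCubes w, y ∈ dyadicCube v := by
  refine ⟨dyadicIndex w.1 y, mem_neighborCubes.2 ⟨rfl, fun i => ?_⟩,
    mem_dyadicCube_dyadicIndex w.1 y⟩
  rw [← hx i]
  have h1 : |y i - x i| < (2⁻¹ : ℝ) ^ w.1 := by
    refine lt_of_le_of_lt ?_ hy
    rw [dist_eq_norm]
    simpa using PiLp.norm_apply_le (y - x) i
  have h2 : |(2 : ℝ) ^ w.1 * y i - 2 ^ w.1 * x i| < 1 := by
    rw [← mul_sub, abs_mul, abs_of_pos (by positivity)]
    calc _ < (2 : ℝ) ^ w.1 * (2⁻¹ : ℝ) ^ w.1 := by gcongr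
      _ = 1 := by rw [← mul_pow]; norm_num
  rw [abs_lt] at h2
  have hx1 := Int.floor_le ((2 : ℝ) ^ w.1 * x i)
  have hx2 := Int.lt_floor_add_one ((2 : ℝ) ^ w.1 * x i)
  constructor
  · show _ ≤ ⌊_⌋
    rw [Int.le_floor]; push_cast; linarith
  · show ⌊_⌋ ≤ _
    rw [← Int.lt_add_one_iff, Int.floor_lt]; push_cast; linarith

theorem measure_ball_le_of_dyadicCube_le {n : ℕ} {ν : Measure (EuclideanSpace ℝ (Fin n))}
    {k : ℕ} {D : ℝ≥0∞}
    (hν : ∀ v : ℕ × (Fin n → ℤ), v.1 = k → ν (dyadicCube v) ≤ D)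
    (x : EuclideanSpace ℝ (Fin n)) : ν (ball x ((2⁻¹ : ℝ) ^ k)) ≤ 3 ^ n * D := by
  set w := dyadicIndex k x
  calc ν (ball x ((2⁻¹ : ℝ) ^ k)) ≤ ν (⋃ v ∈ neighborCubes w, dyadicCube v) := by
        refine measure_mono fun y hy => ?_
        obtain ⟨v, hv, hyv⟩ := exists_mem_neighborCubes (mem_dyadicCube_dyadicIndex k x) hy
        exact mem_iUnion₂.2 ⟨v, hv, hyv⟩
    _ ≤ ∑ v ∈ neighborCubes w, ν (dyadicCube v) := measure_biUnion_finset_le _ _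
    _ ≤ ∑ v ∈ neighborCubes w, D := Finset.sum_le_sum fun v hv => hν v (mem_neighborCubes.1 hv).1
    _ = 3 ^ n * D := by simp [card_neighborCubes]

/-- A compact set of the form `∏ [0, kᵢ]` inside an open set of Baire space: finitely many of the
constraints suffice. -/
theorem exists_forall_lt_le_subset {k : ℕ → ℕ} {V : Set (ℕ → ℕ)} (hV : IsOpen V)
    (h : {σ : ℕ → ℕ | ∀ i, σ i ≤ k i} ⊆ V) :
    ∃ m, {σ : ℕ → ℕ | ∀ i < m, σ i ≤ k i} ⊆ V := by
  by_contra! hcon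
  simp only [not_subset, mem_ofPred_eq] at hcon
  choose σ hσ hσV using hcon
  let b : ℕ → ℕ := fun i => k i + ∑ m ∈ Finset.range (i + 1), σ m i
  have hb : ∀ m, σ m ∈ Set.univ.pi fun i => Set.Iic (b i) := by
    intro m i _
    simp only [mem_Iic, b]
    by_cases hm : i < m
    · exact (hσ m i hm).trans (Nat.le_add_right _ _)
    · refine le_trans ?_ (Nat.le_add_left _ _)
      exact Finset.single_le_sum (f := fun m => σ m i) (fun _ _ => Nat.zero_le _)
        (Finset.mem_range.2 (by omega))
  have hcomp : IsCompact (Set.univ.pi fun i => Set.Iic (b i)) :=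
    isCompact_univ_pi fun i => (Set.finite_Iic (b i)).isCompact
  obtain ⟨τ, -, φ, hφ, hlim⟩ := hcomp.tendsto_subseq hb
  have hτV : τ ∈ Vᶜ := hV.isClosed_compl.mem_of_tendsto hlim
    (Filter.Eventually.of_forall fun j => hσV _)
  refine hτV (h fun i => ?_)
  have hi : Filter.Tendsto (fun j => σ (φ j) i) Filter.atTop (nhds (τ i)) :=
    (tendsto_pi_nhds.1 hlim) i
  refine le_of_tendsto hi ?_
  filter_upwards [Filter.eventually_gt_atTop i] with j hj
  exact hσ _ _ (hj.trans_le hφ.le_apply)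

/-- Capacitability of analytic sets for the dyadic net contents. -/
theorem exists_isCompact_dyadicContent_pos {n : ℕ} {s : ℝ}
    {A : Set (EuclideanSpace ℝ (Fin n))} (hA : AnalyticSet A) (hpos : 0 < dyadicContent s A) :
    ∃ K ⊆ A, IsCompact K ∧ 0 < dyadicContent s K := by
  classical
  rw [AnalyticSet] at hA
  rcases hA with rfl | ⟨f, hf, rfl⟩
  · exact ⟨∅, le_rfl, isCompact_empty, hpos⟩
  obtain ⟨a, ha0, ha⟩ := exists_between hpos
  have hstep : ∀ m (S : Set (ℕ → ℕ)), a < dyadicContent s (f '' S) →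
      ∃ j, a < dyadicContent s (f '' (S ∩ {σ | σ m ≤ j})) := by
    intro m S hS
    by_contra! hcon
    refine absurd (dyadicContent_iUnion_le_of_monotone (A := fun j => f '' (S ∩ {σ | σ m ≤ j}))
      ?_ (ha.trans_le le_top).ne hcon) (not_le.2 (hS.trans_le (dyadicContent_mono ?_)))
    · intro i j hij
      exact image_mono (inter_subset_inter_right _ fun σ (hσ : σ m ≤ i) => hσ.trans hij)
    · rintro _ ⟨σ, hσ, rfl⟩
      exact mem_iUnion.2 ⟨σ m, σ, ⟨hσ, le_refl (σ m)⟩, rfl⟩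
  choose g hg using hstep
  let S : ℕ → {S : Set (ℕ → ℕ) // a < dyadicContent s (f '' S)} := fun m =>
    Nat.rec ⟨univ, by rwa [image_univ]⟩ (fun m T => ⟨_, hg m T.1 T.2⟩) m
  let k : ℕ → ℕ := fun m => g m (S m).1 (S m).2
  have hS : ∀ m, (S m).1 = {σ | ∀ i < m, σ i ≤ k i} := by
    intro m
    induction m with
    | zero => simp [S]
    | succ m ih =>
      have : (S (m + 1)).1 = (S m).1 ∩ {σ | σ m ≤ k m} := rfl
      rw [this, ih]
      ext σ
      exact Nat.forall_lt_succ_right.symm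
  have hcomp : IsCompact {σ : ℕ → ℕ | ∀ i, σ i ≤ k i} := by
    have : {σ : ℕ → ℕ | ∀ i, σ i ≤ k i} = Set.univ.pi fun i => Set.Iic (k i) := by
      ext; simp [Pi.le_def]
    rw [this]
    exact isCompact_univ_pi fun i => (Set.finite_Iic (k i)).isCompact
  refine ⟨f '' {σ | ∀ i, σ i ≤ k i}, image_subset_range _ _, hcomp.image hf, ?_⟩
  by_contra hzero
  have hlt : dyadicContent s (f '' {σ | ∀ i, σ i ≤ k i}) < a / 3 ^ n := by
    rw [le_zero_iff.1 (not_lt.1 hzero)]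
    exact ENNReal.div_pos ha0.ne' (by finiteness)
  obtain ⟨C, hC, hCw⟩ := exists_cover_lt hlt
  let U : Set (EuclideanSpace ℝ (Fin n)) :=
    ⋃ w ∈ C, ⋃ x ∈ dyadicCube w, ball x ((2⁻¹ : ℝ) ^ w.1)
  have hU : IsOpen U := isOpen_biUnion fun w _ => isOpen_biUnion fun x _ => isOpen_ball
  have hKU : {σ : ℕ → ℕ | ∀ i, σ i ≤ k i} ⊆ f ⁻¹' U := by
    intro σ hσ
    obtain ⟨w, hw, hx⟩ := mem_iUnion₂.1 (hC (mem_image_of_mem f hσ))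
    exact mem_iUnion₂.2 ⟨w, hw, mem_iUnion₂.2 ⟨_, hx, mem_ball_self (by positivity)⟩⟩
  obtain ⟨m, hm⟩ := exists_forall_lt_le_subset (hU.preimage hf) hKU
  rw [← hS] at hm
  refine absurd ((S m).2.trans_le ((dyadicContent_mono (image_subset_iff.2 hm)).trans
    (dyadicContent_le_of_subset_neighborCubes (C := C) ?_))) (not_lt.2 ?_)
  · intro y hy
    obtain ⟨w, hw, hy⟩ := mem_iUnion₂.1 hy
    obtain ⟨x, hx, hy⟩ := mem_iUnion₂.1 hy
    obtain ⟨v, hv, hyv⟩ := exists_mem_neighborCubes hx hy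
    exact mem_iUnion₂.2 ⟨w, hw, mem_iUnion₂.2 ⟨v, hv, hyv⟩⟩
  · rw [mul_comm]
    exact ENNReal.mul_le_of_le_div hCw.le

theorem dist_le_of_mem_dyadicCube {n : ℕ} {w : ℕ × (Fin n → ℤ)} {x y : EuclideanSpace ℝ (Fin n)}
    (hx : x ∈ dyadicCube w) (hy : y ∈ dyadicCube w) : dist x y ≤ √n * (2⁻¹ : ℝ) ^ w.1 := by
  have h1 : ∀ i, dist (x i) (y i) ≤ (2⁻¹ : ℝ) ^ w.1 := by
    intro i
    have h2 := Int.abs_sub_lt_one_of_floor_eq_floor ((hx i).trans (hy i).symm)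
    rw [← mul_sub, abs_mul, abs_of_pos (by positivity)] at h2
    rw [Real.dist_eq, inv_pow, ← one_div, le_div_iff₀ (by positivity), mul_comm]
    exact h2.le
  rw [EuclideanSpace.dist_eq]
  calc _ ≤ √(∑ _i : Fin n, ((2⁻¹ : ℝ) ^ w.1) ^ 2) := by
        gcongr with i; exact h1 i
    _ = _ := by simp [Real.sqrt_mul]

theorem ediam_dyadicCube_le {n : ℕ} (w : ℕ × (Fin n → ℤ)) :
    ediam (dyadicCube w) ≤ ENNReal.ofReal (√n * (2⁻¹ : ℝ) ^ w.1) :=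
  ediam_le fun x hx y hy => by
    rw [edist_dist]; exact ENNReal.ofReal_le_ofReal (dist_le_of_mem_dyadicCube hx hy)

theorem dyadicContent_pos_of_hausdorffMeasure_ne_zero {n : ℕ} {s : ℝ} (hs : 0 < s)
    {A : Set (EuclideanSpace ℝ (Fin n))} (hA : μH[s] A ≠ 0) : 0 < dyadicContent s A := by
  by_contra hcon
  have h0 : dyadicContent s A = 0 := le_zero_iff.1 (not_lt.1 hcon)
  have hlt : ∀ j : ℕ, dyadicContent s A < ENNReal.ofReal ((2 : ℝ) ^ (-(s * j))) := fun j => by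
    rw [h0]; exact ENNReal.ofReal_pos.2 (by positivity)
  choose C hC hCw using fun j => exists_cover_lt (hlt j)
  have hlev : ∀ j, ∀ w ∈ C j, j ≤ w.1 := by
    intro j w hw
    have h1 : dyadicWeight n s {w} < ENNReal.ofReal ((2 : ℝ) ^ (-(s * j))) :=
      (measure_mono (singleton_subset_iff.2 hw)).trans_lt (hCw j)
    rw [dyadicWeight_singleton, ENNReal.ofReal_lt_ofReal_iff (by positivity),
      Real.rpow_lt_rpow_left_iff (by norm_num), neg_lt_neg_iff, mul_lt_mul_iff_right₀ hs] at h1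
    exact_mod_cast h1.le
  have hlim : Filter.Tendsto (fun j : ℕ => ENNReal.ofReal (√n * (2⁻¹ : ℝ) ^ j)) Filter.atTop
      (nhds 0) := by
    rw [← ENNReal.ofReal_zero]
    refine ENNReal.tendsto_ofReal ?_
    simpa using (tendsto_pow_atTop_nhds_zero_of_lt_one (r := (2⁻¹ : ℝ)) (by norm_num)
      (by norm_num)).const_mul √n
  have hdiam : ∀ j, ∀ w : C j, ediam (dyadicCube w.1) ≤ ENNReal.ofReal (√n * (2⁻¹ : ℝ) ^ j) := by
    intro j w
    refine (ediam_dyadicCube_le w.1).trans (ENNReal.ofReal_le_ofReal ?_)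
    gcongr ?_ * ?_
    exact pow_le_pow_of_le_one (by norm_num) (by norm_num) (hlev j w.1 w.2)
  have key := Measure.hausdorffMeasure_le_liminf_tsum s A _ hlim (fun j (w : C j) => dyadicCube w.1)
    (Filter.Eventually.of_forall hdiam)
    (Filter.Eventually.of_forall fun j => by simpa [iUnion_subtype] using hC j)
  refine hA (le_zero_iff.1 (key.trans ?_))
  have hbd : ∀ j : ℕ, ∑' w : C j, ediam (dyadicCube w.1) ^ s ≤
      ENNReal.ofReal (√n ^ s) * ENNReal.ofReal ((2 : ℝ) ^ (-(s * j))) := by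
    intro j
    refine le_trans ?_ (mul_le_mul_right (hCw j).le _)
    rw [dyadicWeight_apply, ← tsum_subtype, ← ENNReal.tsum_mul_left]
    refine ENNReal.tsum_le_tsum fun w => ?_
    rw [← ENNReal.ofReal_mul (by positivity)]
    refine (ENNReal.rpow_le_rpow (ediam_dyadicCube_le w.1) hs.le).trans ?_
    rw [ENNReal.ofReal_rpow_of_nonneg (by positivity) hs.le, Real.mul_rpow (by positivity)
      (by positivity), ← Real.rpow_natCast, Real.inv_rpow (by norm_num), ← Real.rpow_neg
      (by norm_num), ← Real.rpow_mul (by norm_num)]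
    apply le_of_eq
    congr 3
    ring
  have hlim2 : Filter.Tendsto (fun j : ℕ => ENNReal.ofReal (√n ^ s) *
      ENNReal.ofReal ((2 : ℝ) ^ (-(s * j)))) Filter.atTop (nhds 0) := by
    simp_rw [← ENNReal.ofReal_mul (show 0 ≤ √(n : ℝ) ^ s by positivity)]
    rw [← ENNReal.ofReal_zero]
    refine ENNReal.tendsto_ofReal ?_
    have : ∀ j : ℕ, (2 : ℝ) ^ (-(s * j)) = ((2 : ℝ) ^ (-s)) ^ j := fun j => by
      rw [← Real.rpow_mul_natCast (by norm_num)]; congr 1; ring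
    simp_rw [this]
    simpa using (tendsto_pow_atTop_nhds_zero_of_lt_one (r := (2 : ℝ) ^ (-s)) (by positivity)
      (Real.rpow_lt_one_of_one_lt_of_neg (by norm_num) (by linarith))).const_mul (√n ^ s)
  rw [← hlim2.liminf_eq]
  exact Filter.liminf_le_liminf (Filter.Eventually.of_forall hbd)

/-- Frostman's lemma. -/
theorem exists_frostman_measure {n : ℕ} {s : ℝ} (hs : 0 < s)
    {A : Set (EuclideanSpace ℝ (Fin n))} (hA : MeasurableSet A) (hpos : μH[s] A ≠ 0) :
    ∃ K ⊆ A, IsCompact K ∧ (∀ x ∈ K, ∀ y ∈ K, dist x y ≤ √n) ∧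
      ∃ μ : Measure (EuclideanSpace ℝ (Fin n)), IsProbabilityMeasure μ ∧ μ Kᶜ = 0 ∧
        ∃ C : ℝ, 0 < C ∧ ∀ x, ∀ r : ℝ, 0 < r → μ (ball x r) ≤ ENNReal.ofReal (C * r ^ s) := by
  obtain ⟨a, ha⟩ : ∃ a : Fin n → ℤ, μH[s] (A ∩ dyadicCube (0, a)) ≠ 0 := by
    by_contra! hcon
    refine hpos (measure_mono_null (fun x hx => ?_) (measure_iUnion_null hcon))
    exact mem_iUnion.2 ⟨_, hx, mem_dyadicCube_dyadicIndex 0 x⟩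
  obtain ⟨K, hKA, hK, hKpos⟩ := exists_isCompact_dyadicContent_pos
    (hA.inter (measurableSet_dyadicCube _)).analyticSet
    (dyadicContent_pos_of_hausdorffMeasure_ne_zero hs ha)
  have hKcube : K ⊆ dyadicCube (0, a) := hKA.trans inter_subset_right
  refine ⟨K, hKA.trans inter_subset_left, hK, fun x hx y hy => ?_, ?_⟩
  · simpa using dist_le_of_mem_dyadicCube (hKcube hx) (hKcube hy)
  set t := dyadicContent s K
  have ht : t ≠ ∞ :=
    ((dyadicContent_le_of_subset_dyadicCube hKcube).trans_lt ENNReal.ofReal_lt_top).ne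
  choose ν hν1 hν2 hν3 using fun m => exists_measure_dyadicCube_le (s := s) m 0 K (0, a) rfl
    hKcube t le_rfl
  have hprob : ∀ m, IsProbabilityMeasure (t⁻¹ • ν m) := fun m =>
    ⟨by simp [hν1, ENNReal.inv_mul_cancel hKpos.ne' ht]⟩
  let P : ℕ → ProbabilityMeasure (EuclideanSpace ℝ (Fin n)) := fun m => ⟨t⁻¹ • ν m, hprob m⟩
  have hcomp := isCompact_setOfPred_probabilityMeasure_mass_eq_compl_isCompact_le
    (u := fun _ => 0) (K := fun _ : ℕ => K) tendsto_const_nhds (fun _ => hK) (Or.inr monotone_const)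
  have hPmem : ∀ m, P m ∈ {μ : ProbabilityMeasure (EuclideanSpace ℝ (Fin n)) |
      ∀ _ : ℕ, μ Kᶜ ≤ 0} := by
    intro m _
    have : ((P m : Measure (EuclideanSpace ℝ (Fin n))) Kᶜ) = 0 := by simp [P, hν2]
    simp [this]
  obtain ⟨μ, hμ, hlim⟩ := hcomp.ultrafilter_le_nhds'
    ((Filter.hyperfilter ℕ).map P)
    (Filter.mem_map.2 (Filter.Eventually.of_forall hPmem))
  have hlim' : Filter.Tendsto P (Filter.hyperfilter ℕ) (nhds μ) := hlim
  refine ⟨μ, inferInstance, ?_, 3 ^ n * t⁻¹.toReal * 2 ^ s + 1, by positivity, fun x r hr => ?_⟩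
  · have := hμ 0
    simpa using this
  rcases lt_or_ge r 1 with hr1 | hr1
  · obtain ⟨k, hk1, hk2⟩ := exists_nat_pow_near_of_lt_one hr hr1.le (y := (2⁻¹ : ℝ)) (by norm_num)
      (by norm_num)
    have hbd : ∀ᶠ m in (Filter.hyperfilter ℕ : Filter ℕ),
        (P m : Measure (EuclideanSpace ℝ (Fin n))) (ball x r) ≤
          ENNReal.ofReal ((3 ^ n * t⁻¹.toReal * 2 ^ s + 1) * r ^ s) := by
      have hle : (Filter.hyperfilter ℕ : Filter ℕ) ≤ Filter.atTop :=
        Nat.cofinite_eq_atTop ▸ Filter.hyperfilter_le_cofinite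
      filter_upwards [hle (Filter.eventually_ge_atTop k)] with m hm
      have h1 : ν m (ball x r) ≤ 3 ^ n * ENNReal.ofReal ((2 : ℝ) ^ (-(s * k))) :=
        (measure_mono (ball_subset_ball hk2)).trans
          (measure_ball_le_of_dyadicCube_le (fun v hv => hv ▸ hν3 m v (Nat.zero_le _)
            (by omega)) x)
      have h2 : (2 : ℝ) ^ (-(s * k)) ≤ 2 ^ s * r ^ s := by
        calc (2 : ℝ) ^ (-(s * k)) = 2 ^ s * ((2⁻¹ : ℝ) ^ (k + 1)) ^ s := by
              rw [← Real.rpow_natCast, Real.inv_rpow (by norm_num), ← Real.rpow_neg (by norm_num),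
                ← Real.rpow_mul (by norm_num), ← Real.rpow_add (by norm_num)]
              congr 1
              push_cast
              ring
          _ ≤ _ := by gcongr
      calc (P m : Measure (EuclideanSpace ℝ (Fin n))) (ball x r) = t⁻¹ * ν m (ball x r) := rfl
        _ ≤ ENNReal.ofReal t⁻¹.toReal * (3 ^ n * ENNReal.ofReal (2 ^ s * r ^ s)) := by
            rw [ENNReal.ofReal_toReal (ENNReal.inv_ne_top.2 hKpos.ne')]
            gcongr
            exact h1.trans (by gcongr)
        _ = ENNReal.ofReal (3 ^ n * t⁻¹.toReal * 2 ^ s * r ^ s) := by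
            rw [show (3 : ℝ≥0∞) ^ n = ENNReal.ofReal (3 ^ n) by simp [ENNReal.ofReal_pow],
              ← ENNReal.ofReal_mul (by positivity), ← ENNReal.ofReal_mul (by positivity)]
            congr 1
            ring
        _ ≤ _ := by
            gcongr
            linarith
    refine (ProbabilityMeasure.le_liminf_measure_open_of_tendsto hlim' isOpen_ball).trans ?_
    exact Filter.liminf_le_of_frequently_le' hbd.frequently
  · refine prob_le_one.trans ?_
    rw [← ENNReal.ofReal_one]
    refine ENNReal.ofReal_le_ofReal ?_
    have : 1 ≤ r ^ s := Real.one_le_rpow hr1 hs.le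
    have : 0 ≤ 3 ^ n * t⁻¹.toReal * 2 ^ s := by positivity
    nlinarith

/-- The orthogonal projections of `ℝⁿ` onto its `ℓ`-dimensional subspaces. -/
def grassmannian (n ℓ : ℕ) : Set (EuclideanSpace ℝ (Fin n) →L[ℝ] EuclideanSpace ℝ (Fin n)) :=
  {P | P.comp P = P ∧ (∀ u v, ⟪P u, v⟫_ℝ = ⟪u, P v⟫_ℝ) ∧
    Module.finrank ℝ (LinearMap.range P.toLinearMap) = ℓ}

section Grassmannian

variable {n ℓ : ℕ} {P P' Q : EuclideanSpace ℝ (Fin n) →L[ℝ] EuclideanSpace ℝ (Fin n)}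

theorem grassmannian_apply_apply (hP : P ∈ grassmannian n ℓ) (v : EuclideanSpace ℝ (Fin n)) :
    P (P v) = P v := congrArg (fun T => T v) hP.1

theorem grassmannian_mul_self (hP : P ∈ grassmannian n ℓ) : P * P = P := hP.1

theorem grassmannian_adjoint (hP : P ∈ grassmannian n ℓ) :
    ContinuousLinearMap.adjoint P = P :=
  ((ContinuousLinearMap.eq_adjoint_iff P P).2 hP.2.1).symm

theorem norm_sq_eq_of_mem_grassmannian (hP : P ∈ grassmannian n ℓ)
    (v : EuclideanSpace ℝ (Fin n)) : ‖v‖ ^ 2 = ‖P v‖ ^ 2 + ‖v - P v‖ ^ 2 := by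
  have h : ⟪P v, v - P v⟫_ℝ = 0 := by
    rw [hP.2.1, map_sub, grassmannian_apply_apply hP, sub_self, inner_zero_right]
  have := norm_add_sq_real (P v) (v - P v)
  rw [h] at this
  simpa using this

theorem norm_apply_le_of_mem_grassmannian (hP : P ∈ grassmannian n ℓ)
    (v : EuclideanSpace ℝ (Fin n)) : ‖P v‖ ≤ ‖v‖ := by
  have := norm_sq_eq_of_mem_grassmannian hP v
  nlinarith [norm_nonneg v, norm_nonneg (P v), sq_nonneg ‖v - P v‖]

theorem norm_sub_apply_le_of_mem_grassmannian (hP : P ∈ grassmannian n ℓ)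
    (v : EuclideanSpace ℝ (Fin n)) : ‖v - P v‖ ≤ ‖v‖ := by
  have := norm_sq_eq_of_mem_grassmannian hP v
  nlinarith [norm_nonneg v, norm_nonneg (v - P v), sq_nonneg ‖P v‖]

theorem norm_le_one_of_mem_grassmannian (hP : P ∈ grassmannian n ℓ) : ‖P‖ ≤ 1 :=
  P.opNorm_le_bound zero_le_one fun v => by
    simpa using norm_apply_le_of_mem_grassmannian hP v

theorem norm_one_sub_le_one_of_mem_grassmannian (hP : P ∈ grassmannian n ℓ) : ‖1 - P‖ ≤ 1 :=
  (1 - P).opNorm_le_bound zero_le_one fun v => by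
    simpa using norm_sub_apply_le_of_mem_grassmannian hP v

theorem norm_diagonal_block_le (hP : P ∈ grassmannian n ℓ) (hP' : P' ∈ grassmannian n ℓ)
    (hQ : Q ∈ grassmannian n ℓ) {ε : ℝ} (h : ‖P - Q‖ ≤ ε) (h' : ‖P' - Q‖ ≤ ε) :
    ‖(1 - Q) * (P - P') * (1 - Q)‖ ≤ 2 * ε * ‖P - P'‖ ∧
      ‖Q * (P - P') * Q‖ ≤ 2 * ε * ‖P - P'‖ := by
  have hq := grassmannian_mul_self hQ
  have hp := grassmannian_mul_self hP
  have hp' := grassmannian_mul_self hP'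
  have hQ1 := norm_le_one_of_mem_grassmannian hQ
  have hQ2 := norm_one_sub_le_one_of_mem_grassmannian hQ
  have key : ∀ A B C : EuclideanSpace ℝ (Fin n) →L[ℝ] EuclideanSpace ℝ (Fin n),
      ∀ a b c : ℝ, ‖A‖ ≤ a → ‖B‖ ≤ b → ‖C‖ ≤ c → ∀ D : EuclideanSpace ℝ (Fin n) →L[ℝ]
      EuclideanSpace ℝ (Fin n), ‖A * B * D * C‖ ≤ a * b * ‖D‖ * c := by
    intro A B C a b c hA hB hC D
    have := (norm_nonneg A).trans hA
    have := (norm_nonneg B).trans hB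
    calc _ ≤ ‖A * B * D‖ * ‖C‖ := norm_mul_le _ _
      _ ≤ ‖A * B‖ * ‖D‖ * ‖C‖ := by gcongr; exact norm_mul_le _ _
      _ ≤ ‖A‖ * ‖B‖ * ‖D‖ * ‖C‖ := by gcongr; exact norm_mul_le _ _
      _ ≤ _ := by gcongr
  have key' : ∀ A B C : EuclideanSpace ℝ (Fin n) →L[ℝ] EuclideanSpace ℝ (Fin n),
      ∀ a b c : ℝ, ‖A‖ ≤ a → ‖B‖ ≤ b → ‖C‖ ≤ c → ∀ D : EuclideanSpace ℝ (Fin n) →L[ℝ]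
      EuclideanSpace ℝ (Fin n), ‖A * D * (B * C)‖ ≤ a * ‖D‖ * (b * c) := by
    intro A B C a b c hA hB hC D
    have := (norm_nonneg A).trans hA
    have := (norm_nonneg B).trans hB
    calc _ ≤ ‖A * D‖ * ‖B * C‖ := norm_mul_le _ _
      _ ≤ ‖A‖ * ‖D‖ * (‖B‖ * ‖C‖) := by gcongr <;> exact norm_mul_le _ _
      _ ≤ _ := by gcongr
  constructor
  · have h1 : (1 - Q) * (P - P') * (1 - Q) =
        (1 - Q) * (P - Q) * (P - P') * (1 - Q) + (1 - Q) * (P - P') * ((P' - Q) * (1 - Q)) := by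
      have e1 : (1 - Q) * (P - Q) = (1 - Q) * P := by
        rw [mul_sub, sub_mul 1 Q Q, hq, one_mul, sub_self, sub_zero]
      have e2 : (P' - Q) * (1 - Q) = P' * (1 - Q) := by
        rw [sub_mul, mul_sub Q, hq, mul_one, sub_self, sub_zero]
      have e3 : P - P' = P * (P - P') + (P - P') * P' := by
        rw [mul_sub, sub_mul, hp, hp']; abel
      rw [e1, e2]
      nth_rw 1 [e3]
      noncomm_ring
    rw [h1]
    refine (norm_add_le _ _).trans ?_
    have a1 := key _ _ _ _ _ _ hQ2 h hQ2 (P - P')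
    have a2 := key' _ _ _ _ _ _ hQ2 h' hQ2 (P - P')
    linarith
  · have h1 : Q * (P - P') * Q = Q * (Q - P) * (P - P') * Q + Q * (P - P') * ((Q - P') * Q) := by
      have e1 : Q * (Q - P) = Q * (1 - P) := by rw [mul_sub, hq, mul_sub, mul_one]
      have e2 : (Q - P') * Q = (1 - P') * Q := by rw [sub_mul, hq, sub_mul, one_mul]
      have e3 : P - P' = (1 - P) * (P - P') + (P - P') * (1 - P') := by
        simp only [mul_sub, sub_mul, hp, hp', one_mul, mul_one]; abel
      rw [e1, e2]
      nth_rw 1 [e3]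
      noncomm_ring
    rw [h1]
    refine (norm_add_le _ _).trans ?_
    rw [norm_sub_rev] at h h'
    have a1 := key _ _ _ _ _ _ hQ1 h hQ1 (P - P')
    have a2 := key' _ _ _ _ _ _ hQ1 h' hQ1 (P - P')
    linarith

/-- Near `Q`, an orthogonal projection is controlled by its off-diagonal block. -/
theorem norm_sub_le_off_diagonal (hP : P ∈ grassmannian n ℓ) (hP' : P' ∈ grassmannian n ℓ)
    (hQ : Q ∈ grassmannian n ℓ) {ε : ℝ} (h : ‖P - Q‖ ≤ ε) (h' : ‖P' - Q‖ ≤ ε) (hε : ε ≤ 1 / 8) :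
    ‖P - P'‖ ≤ 4 * ‖(1 - Q) * (P - P') * Q‖ := by
  obtain ⟨h1, h2⟩ := norm_diagonal_block_le hP hP' hQ h h'
  have hadj : ‖Q * (P - P') * (1 - Q)‖ = ‖(1 - Q) * (P - P') * Q‖ := by
    rw [← (ContinuousLinearMap.adjoint (𝕜 := ℝ) (E := EuclideanSpace ℝ (Fin n))
      (F := EuclideanSpace ℝ (Fin n))).norm_map]
    congr 1
    simp only [ContinuousLinearMap.mul_def, ContinuousLinearMap.adjoint_comp, map_sub,
      grassmannian_adjoint hP, grassmannian_adjoint hP', grassmannian_adjoint hQ]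
    rw [ContinuousLinearMap.adjoint_one]
    simp only [← ContinuousLinearMap.mul_def, mul_assoc]
  have hdec : P - P' = (1 - Q) * (P - P') * (1 - Q) + Q * (P - P') * Q +
      (Q * (P - P') * (1 - Q) + (1 - Q) * (P - P') * Q) := by
    simp only [mul_sub, sub_mul, one_mul, mul_one]
    abel
  have h3 : ‖P - P'‖ ≤ 2 * ε * ‖P - P'‖ + 2 * ε * ‖P - P'‖ + 2 * ‖(1 - Q) * (P - P') * Q‖ := by
    have a1 := (congrArg norm hdec).le.trans ((norm_add_le _ _).trans
      (add_le_add (norm_add_le _ _) (norm_add_le _ _)))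
    rw [hadj] at a1
    linarith
  nlinarith [norm_nonneg (P - P')]

end Grassmannian

theorem OrthonormalBasis.sum_inner_smul_coe {E ι : Type*} [NormedAddCommGroup E]
    [InnerProductSpace ℝ E] [Fintype ι] {S : Submodule ℝ E} (b : OrthonormalBasis ι ℝ S) {y : E}
    (hy : y ∈ S) : ∑ i, ⟪(b i : E), y⟫_ℝ • (b i : E) = y := by
  have h := congrArg (Subtype.val) (b.sum_repr' ⟨y, hy⟩)
  simpa [Submodule.coe_inner] using h

theorem exists_chart {n m : ℕ} {Q : EuclideanSpace ℝ (Fin n) →L[ℝ] EuclideanSpace ℝ (Fin n)}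
    (hQ : Q ∈ grassmannian n (m + 1)) {e : EuclideanSpace ℝ (Fin n)} (he : ‖e‖ = 1)
    (hQe : 1 / 2 ≤ ‖Q e‖) :
    ∃ T : (EuclideanSpace ℝ (Fin n) →L[ℝ] EuclideanSpace ℝ (Fin n)) →
        Fin (n - (m + 1)) × Fin m → ℝ,
      (∀ P ∈ grassmannian n (m + 1), ∀ i, |T P i| ≤ 1) ∧
      ∀ P ∈ grassmannian n (m + 1), ∀ P' ∈ grassmannian n (m + 1), ∀ δ : ℝ,
        ‖P - Q‖ ≤ 1 / 32 → ‖P' - Q‖ ≤ 1 / 32 → ‖e - P e‖ ≤ δ → ‖e - P' e‖ ≤ δ →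
        (∀ i, |T P i - T P' i| ≤ δ) → ‖P - P'‖ ≤ (8 * (m * (n - (m + 1) : ℕ)) + 32) * δ := by
  classical
  set S : Submodule ℝ (EuclideanSpace ℝ (Fin n)) := LinearMap.range Q.toLinearMap with hS
  have hSr : Module.finrank ℝ S = m + 1 := hQ.2.2
  have hmemS : ∀ v, Q v ∈ S := fun v => ⟨v, rfl⟩
  have hmemSo : ∀ v, v - Q v ∈ Sᗮ := by
    intro v
    rw [Submodule.mem_orthogonal]
    rintro _ ⟨y, rfl⟩
    show ⟪Q y, v - Q v⟫_ℝ = 0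
    rw [hQ.2.1, map_sub, grassmannian_apply_apply hQ, sub_self, inner_zero_right]
  have hSor : Module.finrank ℝ Sᗮ = n - (m + 1) := by
    have := S.finrank_add_finrank_orthogonal
    rw [hSr, finrank_euclideanSpace_fin] at this
    omega
  have hQepos : 0 < ‖Q e‖ := by linarith
  let f : S := ⟨‖Q e‖⁻¹ • Q e, S.smul_mem _ (hmemS e)⟩
  have hf : ‖f‖ = 1 := by
    show ‖‖Q e‖⁻¹ • Q e‖ = 1
    rw [norm_smul, norm_inv, norm_norm, inv_mul_cancel₀ hQepos.ne']
  obtain ⟨u, hu⟩ := Orthonormal.exists_orthonormalBasis_extension_of_card_eq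
    (ι := Fin (m + 1)) (by simpa using hSr) (v := fun _ => f) (s := {0}) (by
      rw [orthonormal_iff_ite]
      rintro ⟨i, rfl⟩ ⟨j, rfl⟩
      simp [hf])
  have hu0 : (u 0 : EuclideanSpace ℝ (Fin n)) = ‖Q e‖⁻¹ • Q e := by rw [hu 0 rfl]
  let w : OrthonormalBasis (Fin (n - (m + 1))) ℝ Sᗮ :=
    (stdOrthonormalBasis ℝ Sᗮ).reindex (finCongr hSor)
  have hun : ∀ j, ‖(u j : EuclideanSpace ℝ (Fin n))‖ = 1 := fun j => u.orthonormal.1 j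
  have hwn : ∀ j, ‖(w j : EuclideanSpace ℝ (Fin n))‖ = 1 := fun j => w.orthonormal.1 j
  refine ⟨fun P ij => ⟪(w ij.1 : EuclideanSpace ℝ (Fin n)), P (u ij.2.succ)⟫_ℝ,
    fun P hP ij => ?_, fun P hP P' hP' δ h h' hPe hPe' hT => ?_⟩
  · refine (abs_real_inner_le_norm _ _).trans ?_
    rw [hwn, one_mul]
    exact (norm_apply_le_of_mem_grassmannian hP _).trans (hun _).le
  set D := P - P' with hD
  have hδ : 0 ≤ δ := (norm_nonneg _).trans hPe
  have hcompl : ∀ x, ‖x - Q x‖ ≤ ∑ i, |⟪(w i : EuclideanSpace ℝ (Fin n)), x⟫_ℝ| := by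
    intro x
    have hwx : ∀ i, ⟪(w i : EuclideanSpace ℝ (Fin n)), x⟫_ℝ =
        ⟪(w i : EuclideanSpace ℝ (Fin n)), x - Q x⟫_ℝ := by
      intro i
      rw [inner_sub_right, Submodule.inner_left_of_mem_orthogonal (hmemS x) (w i).2, sub_zero]
    calc ‖x - Q x‖ = ‖∑ i, ⟪(w i : EuclideanSpace ℝ (Fin n)), x - Q x⟫_ℝ •
          (w i : EuclideanSpace ℝ (Fin n))‖ := by rw [w.sum_inner_smul_coe (hmemSo x)]
      _ ≤ ∑ i, ‖⟪(w i : EuclideanSpace ℝ (Fin n)), x - Q x⟫_ℝ •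
          (w i : EuclideanSpace ℝ (Fin n))‖ := norm_sum_le _ _
      _ = _ := by
        refine Finset.sum_congr rfl fun i _ => ?_
        rw [norm_smul, hwn, mul_one, hwx, Real.norm_eq_abs]
  have hcol : ∀ j : Fin m, ‖D (u j.succ) - Q (D (u j.succ))‖ ≤ (n - (m + 1) : ℕ) * δ := by
    intro j
    refine (hcompl _).trans ?_
    calc _ ≤ ∑ _i : Fin (n - (m + 1)), δ := by
          refine Finset.sum_le_sum fun i _ => ?_
          have := hT (i, j)
          rwa [← inner_sub_right] at this
      _ = _ := by simp
  have hcol0 : ‖D (u 0) - Q (D (u 0))‖ ≤ 4 * δ + 1 / 8 * ‖D‖ := by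
    have hDe : ‖D e‖ ≤ 2 * δ := by
      have : D e = (e - P' e) - (e - P e) := by simp [hD]
      rw [this]
      exact (norm_sub_le _ _).trans (by linarith)
    have h1 : D (Q e) - Q (D (Q e)) =
        (D e - Q (D e)) - ((1 - Q) * (P - P') * (1 - Q)) e := by
      simp only [mul_apply_eq_comp, sub_apply,
        one_apply_eq_self, hD, map_sub]
      abel
    have h2 : ‖D (Q e) - Q (D (Q e))‖ ≤ 2 * δ + 2 * (1 / 32) * ‖D‖ := by
      rw [h1]
      refine (norm_sub_le _ _).trans (add_le_add
        ((norm_sub_apply_le_of_mem_grassmannian hQ _).trans hDe) ?_)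
      refine (ContinuousLinearMap.le_opNorm _ _).trans ?_
      rw [he, mul_one]
      exact (norm_diagonal_block_le hP hP' hQ h h').1
    rw [hu0, map_smul, map_smul, ← smul_sub, norm_smul, norm_inv, norm_norm]
    have h3 : ‖Q e‖⁻¹ ≤ 2 := by
      rw [inv_le_comm₀ hQepos (by norm_num)]; linarith
    calc _ ≤ 2 * (2 * δ + 2 * (1 / 32) * ‖D‖) := by gcongr
      _ = _ := by ring
  have hoff : ‖(1 - Q) * D * Q‖ ≤ 4 * δ + 1 / 8 * ‖D‖ + m * ((n - (m + 1) : ℕ) * δ) := by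
    refine ContinuousLinearMap.opNorm_le_bound _ (by positivity) fun v => ?_
    have h1 : ((1 - Q) * D * Q) v =
        ∑ j, ⟪(u j : EuclideanSpace ℝ (Fin n)), Q v⟫_ℝ • (D (u j) - Q (D (u j))) := by
      have : ((1 - Q) * D * Q) v = D (Q v) - Q (D (Q v)) := rfl
      rw [this]
      conv_lhs => rw [← u.sum_inner_smul_coe (hmemS v)]
      simp only [map_sum, map_smul, smul_sub, Finset.sum_sub_distrib]
    have h2 : ∀ j, |⟪(u j : EuclideanSpace ℝ (Fin n)), Q v⟫_ℝ| ≤ ‖v‖ := by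
      intro j
      refine (abs_real_inner_le_norm _ _).trans ?_
      rw [hun, one_mul]
      exact norm_apply_le_of_mem_grassmannian hQ _
    rw [h1]
    calc _ ≤ ∑ j, ‖⟪(u j : EuclideanSpace ℝ (Fin n)), Q v⟫_ℝ • (D (u j) - Q (D (u j)))‖ :=
          norm_sum_le _ _
      _ ≤ ∑ j, ‖v‖ * ‖D (u j) - Q (D (u j))‖ := by
          refine Finset.sum_le_sum fun j _ => ?_
          rw [norm_smul]
          gcongr
          exact h2 j
      _ ≤ ‖v‖ * (4 * δ + 1 / 8 * ‖D‖) + ∑ _j : Fin m, ‖v‖ * ((n - (m + 1) : ℕ) * δ) := by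
          rw [Fin.sum_univ_succ]
          gcongr with j
          exact hcol j
      _ = _ := by simp; ring
  have hfin := norm_sub_le_off_diagonal hP hP' hQ h h' (by norm_num)
  rw [← hD] at hfin
  linarith

theorem measure_le_of_chart {X ι : Type*} [PseudoMetricSpace X] [MeasurableSpace X] [Fintype ι]
    {lam : Measure X} {S : Set X} {T : X → ι → ℝ} (hT : ∀ x ∈ S, ∀ i, |T x i| ≤ 1)
    {δ ρ : ℝ} (hδ : 0 < δ) (hδ1 : δ ≤ 1) {B : ℝ≥0∞} (hB : ∀ x ∈ S, lam (closedBall x ρ) ≤ B)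
    (hST : ∀ x ∈ S, ∀ y ∈ S, (∀ i, |T x i - T y i| ≤ δ) → dist x y ≤ ρ) :
    lam S ≤ ENNReal.ofReal ((5 / δ) ^ Fintype.card ι) * B := by
  classical
  set N : ℤ := ⌈1 / δ⌉
  let I : Finset (ι → ℤ) := Fintype.piFinset fun _ => Finset.Icc (-N) N
  let g : X → ι → ℤ := fun x i => ⌊T x i / δ⌋
  have hN : 1 / δ ≤ N := Int.le_ceil _
  have hN0 : (0 : ℝ) ≤ N := le_trans (by positivity) hN
  have hN0' : 0 ≤ N := by exact_mod_cast hN0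
  have hgI : ∀ x ∈ S, g x ∈ I := by
    intro x hx
    refine Fintype.mem_piFinset.2 fun i => Finset.mem_Icc.2 ?_
    have h1 := abs_le.1 (hT x hx i)
    have h2 : T x i / δ ≤ 1 / δ := by gcongr; exact h1.2
    have h3 : -(1 / δ) ≤ T x i / δ := by rw [← neg_div]; gcongr; exact h1.1
    constructor
    · rw [Int.le_floor]; push_cast; linarith
    · rw [← Int.lt_add_one_iff, Int.floor_lt]; push_cast; linarith
  have hcell : ∀ a ∈ I, lam (S ∩ g ⁻¹' {a}) ≤ B := by
    intro a _
    rcases (S ∩ g ⁻¹' {a}).eq_empty_or_nonempty with h | ⟨x, hx, hxa⟩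
    · simp [h]
    · refine (measure_mono ?_).trans (hB x hx)
      rintro y ⟨hy, hya⟩
      refine hST y hy x hx fun i => ?_
      have h1 : ⌊T y i / δ⌋ = ⌊T x i / δ⌋ := (congrFun hya i).trans (congrFun hxa i).symm
      have h2 := Int.abs_sub_lt_one_of_floor_eq_floor h1
      rw [← sub_div, abs_div, abs_of_pos hδ, div_lt_one hδ] at h2
      exact h2.le
  calc lam S ≤ lam (⋃ a ∈ I, S ∩ g ⁻¹' {a}) :=
        measure_mono fun x hx => mem_iUnion₂.2 ⟨g x, hgI x hx, hx, rfl⟩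
    _ ≤ ∑ a ∈ I, lam (S ∩ g ⁻¹' {a}) := measure_biUnion_finset_le _ _
    _ ≤ ∑ a ∈ I, B := Finset.sum_le_sum hcell
    _ = ENNReal.ofReal I.card * B := by simp
    _ ≤ _ := by
        gcongr
        rw [Fintype.card_piFinset]
        simp only [Int.card_Icc, Finset.prod_const, Finset.card_univ, Nat.cast_pow]
        gcongr
        have h4 : ((N + 1 - -N).toNat : ℝ) = 2 * N + 1 := by
          have : (((N + 1 - -N).toNat : ℤ) : ℝ) = ((N + 1 - -N : ℤ) : ℝ) := by
            rw [Int.toNat_of_nonneg (by omega)]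
          push_cast at this
          linarith
        rw [h4]
        have h5 : (N : ℝ) < 1 / δ + 1 := Int.ceil_lt_add_one _
        have h6 : 1 ≤ 1 / δ := (one_le_div hδ).2 hδ1
        have h7 : 5 / δ = 5 * (1 / δ) := by ring
        rw [h7]
        linarith

theorem totallyBounded_grassmannian (n ℓ : ℕ) : TotallyBounded (grassmannian n ℓ) := by
  have : ProperSpace (EuclideanSpace ℝ (Fin n) →L[ℝ] EuclideanSpace ℝ (Fin n)) :=
    FiniteDimensional.proper ℝ _
  exact (isCompact_closedBall 0 1).totallyBounded.subset fun P hP => by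
    simpa using norm_le_one_of_mem_grassmannian hP

section

variable {n m : ℕ} {β c : ℝ}
  {lam : Measure (EuclideanSpace ℝ (Fin n) →L[ℝ] EuclideanSpace ℝ (Fin n))}

theorem measure_univ_le_of_grassmannian {ℓ : ℕ}
    (hG : lam (grassmannian n ℓ)ᶜ = 0)
    (hlam : ∀ P ∈ grassmannian n ℓ, ∀ r : ℝ, 0 < r →
      lam (closedBall P r) ≤ ENNReal.ofReal (c * r ^ β)) :
    lam univ ≤ ENNReal.ofReal (c * 2 ^ β) := by
  rcases (grassmannian n ℓ).eq_empty_or_nonempty with h | ⟨P, hP⟩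
  · rw [h, compl_empty] at hG
    simp [hG]
  rw [← union_compl_self (grassmannian n ℓ)]
  refine (measure_union_le _ _).trans ?_
  rw [hG, add_zero]
  refine (measure_mono fun R hR => ?_).trans (hlam P hP 2 (by norm_num))
  rw [mem_closedBall, dist_eq_norm]
  refine (norm_sub_le _ _).trans ?_
  linarith [norm_le_one_of_mem_grassmannian hP, norm_le_one_of_mem_grassmannian hR]

/-- The measure of the set of planes almost containing a given direction. -/
theorem exists_measure_slab_le (hc : 0 < c) (hG : lam (grassmannian n (m + 1))ᶜ = 0)
    (hlam : ∀ P ∈ grassmannian n (m + 1), ∀ r : ℝ, 0 < r →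
      lam (closedBall P r) ≤ ENNReal.ofReal (c * r ^ β))
    {τ : ℝ} (hτ : τ = β - m * (n - (m + 1) : ℕ)) (hτ0 : 0 ≤ τ) :
    ∃ C : ℝ, 0 < C ∧ ∀ e, ‖e‖ = 1 → ∀ δ : ℝ, 0 < δ →
      lam {P | ‖e - P e‖ ≤ δ} ≤ ENNReal.ofReal (C * δ ^ τ) := by
  obtain ⟨t, htG, htfin, htcov⟩ := Metric.finite_approx_of_totallyBounded
    (totallyBounded_grassmannian n (m + 1)) (1 / 32) (by norm_num)
  lift t to Finset (EuclideanSpace ℝ (Fin n) →L[ℝ] EuclideanSpace ℝ (Fin n)) using htfin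
  set A : ℝ := 8 * (m * (n - (m + 1) : ℕ)) + 32
  set d : ℕ := (n - (m + 1)) * m
  have hA : 0 < A := by positivity
  refine ⟨t.card * (5 ^ d * (c * A ^ β)) + c * 2 ^ β * 4 ^ τ, by positivity,
    fun e he δ hδ => ?_⟩
  rcases le_or_gt δ (1 / 4) with hδ4 | hδ4
  · have hpiece : ∀ Q ∈ t, lam ({P ∈ grassmannian n (m + 1) | ‖e - P e‖ ≤ δ} ∩ ball Q (1 / 32)) ≤
        ENNReal.ofReal (5 ^ d * (c * A ^ β) * δ ^ τ) := by
      intro Q hQ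
      rcases lt_or_ge ‖Q e‖ (1 / 2) with hQe | hQe
      · have : {P ∈ grassmannian n (m + 1) | ‖e - P e‖ ≤ δ} ∩ ball Q (1 / 32) = ∅ := by
          rw [eq_empty_iff_forall_notMem]
          rintro P ⟨⟨hP, hPe⟩, hPQ⟩
          rw [mem_ball, dist_eq_norm] at hPQ
          have h1 : ‖(P - Q) e‖ ≤ 1 / 32 := by
            refine ((P - Q).le_opNorm e).trans ?_
            rw [he, mul_one]; exact hPQ.le
          have h2 : e = (e - P e) + (P - Q) e + Q e := by simp
          have h3 := (congrArg norm h2).le.trans (norm_add₃_le)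
          linarith
        rw [this, measure_empty]
        exact zero_le
      · obtain ⟨T, hT1, hT2⟩ := exists_chart (htG hQ) he hQe
        have := measure_le_of_chart (lam := lam) (T := T) (δ := δ) (ρ := A * δ)
          (S := {P ∈ grassmannian n (m + 1) | ‖e - P e‖ ≤ δ} ∩ ball Q (1 / 32))
          (B := ENNReal.ofReal (c * (A * δ) ^ β))
          (fun P hP => hT1 P hP.1.1) hδ (by linarith)
          (fun P hP => hlam P hP.1.1 _ (by positivity))
          (fun P hP P' hP' h => by
            have h1 := hP.2
            have h2 := hP'.2
            rw [mem_ball, dist_eq_norm] at h1 h2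
            rw [dist_eq_norm]
            exact hT2 P hP.1.1 P' hP'.1.1 δ h1.le h2.le hP.1.2 hP'.1.2 h)
        refine this.trans ?_
        rw [← ENNReal.ofReal_mul (by positivity)]
        refine ENNReal.ofReal_le_ofReal (le_of_eq ?_)
        have hcard : Fintype.card (Fin (n - (m + 1)) × Fin m) = d := by simp [d]
        have h8 : β = d + τ := by simp only [hτ, d]; push_cast; ring
        rw [hcard, Real.mul_rpow hA.le hδ.le]
        have h9 : δ ^ β = δ ^ d * δ ^ τ := by rw [h8, Real.rpow_add hδ, Real.rpow_natCast]
        rw [h9, div_pow]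
        field_simp
    calc lam {P | ‖e - P e‖ ≤ δ} ≤ lam ((⋃ Q ∈ t, {P ∈ grassmannian n (m + 1) | ‖e - P e‖ ≤ δ} ∩
          ball Q (1 / 32)) ∪ (grassmannian n (m + 1))ᶜ) := by
          refine measure_mono fun P hP => ?_
          by_cases hPG : P ∈ grassmannian n (m + 1)
          · obtain ⟨Q, hQ, hPQ⟩ := mem_iUnion₂.1 (htcov hPG)
            exact Or.inl (mem_iUnion₂.2 ⟨Q, hQ, ⟨hPG, hP⟩, hPQ⟩)
          · exact Or.inr hPG
      _ ≤ ∑ Q ∈ t, ENNReal.ofReal (5 ^ d * (c * A ^ β) * δ ^ τ) := by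
          refine (measure_union_le _ _).trans ?_
          rw [hG, add_zero]
          exact (measure_biUnion_finset_le _ _).trans (Finset.sum_le_sum hpiece)
      _ = ENNReal.ofReal (t.card * (5 ^ d * (c * A ^ β) * δ ^ τ)) := by
          rw [Finset.sum_const, nsmul_eq_mul,
            ENNReal.ofReal_mul (p := (t.card : ℝ)) (by positivity),
            ENNReal.ofReal_natCast]
      _ ≤ _ := by
          refine ENNReal.ofReal_le_ofReal ?_
          have : 0 ≤ c * 2 ^ β * 4 ^ τ * δ ^ τ := by positivity
          linarith
  · refine ((measure_mono (subset_univ _)).trans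
      (measure_univ_le_of_grassmannian hG hlam)).trans (ENNReal.ofReal_le_ofReal ?_)
    have h1 : 1 ≤ (4 : ℝ) ^ τ * δ ^ τ := by
      rw [← Real.mul_rpow (by norm_num) hδ.le]
      exact Real.one_le_rpow (by linarith) hτ0
    have h2 : 0 ≤ t.card * (5 ^ d * (c * A ^ β)) * δ ^ τ := by positivity
    have h3 : 0 < c * 2 ^ β := by positivity
    nlinarith

end

theorem exp_neg_sq_le_rpow {p u : ℝ} (hp : 0 ≤ p) (hu : 0 ≤ u) :
    Real.exp (-(u ^ 2 / 8)) ≤ Real.exp (2 * p ^ 2) * (1 + u) ^ (-p) := by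
  rw [Real.rpow_def_of_pos (by linarith), ← Real.exp_add, Real.exp_le_exp]
  have h1 := Real.log_le_sub_one_of_pos (show 0 < 1 + u by linarith)
  nlinarith [mul_le_mul_of_nonneg_left h1 hp, sq_nonneg (u - 4 * p)]

/-- Layer-cake bound for a Gaussian integral from polynomial growth of sublevel sets. -/
theorem lintegral_exp_neg_sq_le {X : Type*} [MeasurableSpace X] {ν : Measure X} {f : X → ℝ}
    (hf : Measurable f) (hf0 : ∀ x, 0 ≤ f x) {s D : ℝ} (hs : 0 ≤ s) (hD : 0 ≤ D)
    (h : ∀ u : ℝ, 1 ≤ u → ν {x | f x < u} ≤ ENNReal.ofReal (D * u ^ s)) :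
    ∫⁻ x, ENNReal.ofReal (Real.exp (-(f x ^ 2 / 8))) ∂ν ≤
      ENNReal.ofReal (2 * Real.exp (2 * (s + 1) ^ 2) * 2 ^ s * D) := by
  set A : ℝ := Real.exp (2 * (s + 1) ^ 2)
  let S : ℕ → Set X := fun k => {x | f x < 2 ^ (k + 1)}
  have hSm : ∀ k, MeasurableSet (S k) := fun k => measurableSet_lt hf measurable_const
  have hpt : ∀ x, ENNReal.ofReal (Real.exp (-(f x ^ 2 / 8))) ≤
      ∑' k : ℕ, (S k).indicator (fun _ => ENNReal.ofReal (A * ((2 : ℝ) ^ k) ^ (-(s + 1)))) x := by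
    intro x
    obtain ⟨k, hk1, hk2⟩ := exists_nat_pow_near (x := 1 + f x) (y := (2 : ℝ))
      (by linarith [hf0 x]) (by norm_num)
    refine le_trans ?_ (ENNReal.le_tsum k)
    rw [indicator_of_mem (show x ∈ S k by show f x < 2 ^ (k + 1); linarith)]
    refine ENNReal.ofReal_le_ofReal ((exp_neg_sq_le_rpow (p := s + 1) (by linarith)
      (hf0 x)).trans ?_)
    refine mul_le_mul_of_nonneg_left ?_ (by positivity)
    exact Real.rpow_le_rpow_of_nonpos (by positivity) hk1 (by linarith)
  have hterm : ∀ k : ℕ, A * ((2 : ℝ) ^ k) ^ (-(s + 1)) * (D * (2 ^ (k + 1)) ^ s) =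
      A * D * 2 ^ s * (1 / 2) ^ k := by
    intro k
    rw [pow_succ, Real.mul_rpow (by positivity) (by norm_num), Real.rpow_neg (by positivity),
      Real.rpow_add (by positivity), Real.rpow_one]
    have : (0 : ℝ) < ((2 : ℝ) ^ k) ^ s := by positivity
    field_simp
    rw [one_div, inv_pow]
    field_simp
  calc _ ≤ ∫⁻ x, ∑' k : ℕ, (S k).indicator
        (fun _ => ENNReal.ofReal (A * ((2 : ℝ) ^ k) ^ (-(s + 1)))) x ∂ν := lintegral_mono hpt
    _ = ∑' k : ℕ, ENNReal.ofReal (A * ((2 : ℝ) ^ k) ^ (-(s + 1))) * ν (S k) := by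
        rw [lintegral_tsum fun k => (measurable_const.indicator (hSm k)).aemeasurable]
        simp_rw [lintegral_indicator_const (hSm _)]
    _ ≤ ∑' k : ℕ, ENNReal.ofReal (A * D * 2 ^ s * (1 / 2) ^ k) := by
        refine ENNReal.tsum_le_tsum fun k => ?_
        rw [← hterm, ENNReal.ofReal_mul (p := A * _) (by positivity)]
        gcongr
        exact h _ (one_le_pow₀ (by norm_num))
    _ = ENNReal.ofReal (2 * A * 2 ^ s * D) := by
        rw [← ENNReal.ofReal_tsum_of_nonneg (fun k => by positivity)
          (summable_geometric_two.mul_left _), tsum_mul_left, tsum_geometric_two]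
        congr 1
        ring

/-- Averaged Gaussian decay of the component orthogonal to a random plane. -/
theorem exists_lintegral_exp_le {n m : ℕ} {β c : ℝ}
    {lam : Measure (EuclideanSpace ℝ (Fin n) →L[ℝ] EuclideanSpace ℝ (Fin n))} (hc : 0 < c)
    (hG : lam (grassmannian n (m + 1))ᶜ = 0)
    (hlam : ∀ P ∈ grassmannian n (m + 1), ∀ r : ℝ, 0 < r →
      lam (closedBall P r) ≤ ENNReal.ofReal (c * r ^ β))
    {τ : ℝ} (hτ : τ = β - m * (n - (m + 1) : ℕ)) :
    ∃ C : ℝ, 0 < C ∧ ∀ ξ : EuclideanSpace ℝ (Fin n),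
      ∫⁻ P, ENNReal.ofReal (Real.exp (-(‖ξ - P ξ‖ ^ 2 / 8))) ∂lam ≤
        ENNReal.ofReal (C * (1 + ‖ξ‖) ^ (-τ)) := by
  have htriv : ∀ ξ : EuclideanSpace ℝ (Fin n),
      ∫⁻ P, ENNReal.ofReal (Real.exp (-(‖ξ - P ξ‖ ^ 2 / 8))) ∂lam ≤
        ENNReal.ofReal (c * 2 ^ β) := by
    intro ξ
    refine le_trans (lintegral_mono (g := fun _ => 1) fun P => ?_) ?_
    · rw [← ENNReal.ofReal_one]
      refine ENNReal.ofReal_le_ofReal (Real.exp_le_one_iff.2 ?_)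
      have : 0 ≤ ‖ξ - P ξ‖ ^ 2 := by positivity
      linarith
    · simpa using measure_univ_le_of_grassmannian hG hlam
  rcases lt_or_ge τ 0 with hτ0 | hτ0
  · refine ⟨c * 2 ^ β, by positivity, fun ξ => (htriv ξ).trans (ENNReal.ofReal_le_ofReal ?_)⟩
    exact le_mul_of_one_le_right (by positivity)
      (Real.one_le_rpow (by linarith [norm_nonneg ξ]) (by linarith))
  obtain ⟨C, hC, hslab⟩ := exists_measure_slab_le hc hG hlam hτ hτ0
  set A : ℝ := Real.exp (2 * (τ + 1) ^ 2)
  refine ⟨c * 2 ^ β * 2 ^ τ + 2 * A * C * 4 ^ τ, by positivity, fun ξ => ?_⟩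
  rcases lt_or_ge ‖ξ‖ 1 with hξ | hξ
  · refine (htriv ξ).trans (ENNReal.ofReal_le_ofReal ?_)
    have h1 : 1 ≤ (2 : ℝ) ^ τ * (1 + ‖ξ‖) ^ (-τ) := by
      rw [Real.rpow_neg (by positivity), ← div_eq_mul_inv, one_le_div (by positivity)]
      gcongr
      linarith
    have h2 : 0 ≤ 2 * A * C * 4 ^ τ * (1 + ‖ξ‖) ^ (-τ) := by positivity
    have h3 : 0 < c * 2 ^ β := by positivity
    nlinarith
  have hξ0 : 0 < ‖ξ‖ := by linarith
  refine (lintegral_exp_neg_sq_le (f := fun P : EuclideanSpace ℝ (Fin n) →L[ℝ]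
    EuclideanSpace ℝ (Fin n) => ‖ξ - P ξ‖) (s := τ) (D := C * ‖ξ‖ ^ (-τ)) (by fun_prop)
    (fun _ => norm_nonneg _) hτ0 (by positivity) fun u hu => ?_).trans
    (ENNReal.ofReal_le_ofReal ?_)
  · have hu0 : 0 < u := by linarith
    rw [mul_assoc, Real.rpow_neg hξ0.le, mul_comm (_)⁻¹, ← div_eq_mul_inv,
      ← Real.div_rpow hu0.le hξ0.le]
    refine le_trans (measure_mono fun P hP => ?_)
      (hslab (‖ξ‖⁻¹ • ξ) (by simp [norm_smul, hξ0.ne']) _ (by positivity))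
    show ‖‖ξ‖⁻¹ • ξ - P (‖ξ‖⁻¹ • ξ)‖ ≤ _
    rw [map_smul, ← smul_sub, norm_smul, norm_inv, norm_norm, div_eq_inv_mul]
    gcongr
    exact le_of_lt hP
  · have h1 : ‖ξ‖ ^ (-τ) ≤ 2 ^ τ * (1 + ‖ξ‖) ^ (-τ) := by
      rw [Real.rpow_neg hξ0.le, Real.rpow_neg (by positivity), ← div_eq_mul_inv,
        inv_le_comm₀ (by positivity) (by positivity), inv_div, div_le_iff₀ (by positivity),
        ← Real.mul_rpow (by positivity) (by positivity)]
      gcongr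
      linarith
    have h2 : (4 : ℝ) ^ τ = 2 ^ τ * 2 ^ τ := by
      rw [← Real.mul_rpow (by norm_num) (by norm_num)]; norm_num
    rw [h2]
    have h3 : 0 ≤ c * 2 ^ β * 2 ^ τ * (1 + ‖ξ‖) ^ (-τ) := by positivity
    have h4 : 0 ≤ 2 * A * C * 2 ^ τ := by positivity
    nlinarith [mul_le_mul_of_nonneg_left h1 h4]

section Gaussian

variable {n : ℕ} (b : OrthonormalBasis (Fin n) ℝ (EuclideanSpace ℝ (Fin n)))

theorem OrthonormalBasis.measurePreserving_symm_toLp :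
    MeasurePreserving (fun v : Fin n → ℝ => b.repr.symm (WithLp.toLp 2 v)) :=
  b.measurePreserving_repr_symm.comp (PiLp.volume_preserving_toLp (Fin n))

theorem OrthonormalBasis.measurableEmbedding_symm_toLp :
    MeasurableEmbedding (fun v : Fin n → ℝ => b.repr.symm (WithLp.toLp 2 v)) :=
  b.repr.symm.toHomeomorph.measurableEmbedding.comp
    (MeasurableEquiv.toLp 2 (Fin n → ℝ)).measurableEmbedding

theorem gaussian_comp_symm_toLp (w : Fin n → ℝ) (z : EuclideanSpace ℝ (Fin n)) (v : Fin n → ℝ) :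
    -∑ i, (w i : ℂ) * ((⟪b i, b.repr.symm (WithLp.toLp 2 v)⟫_ℝ : ℝ) : ℂ) ^ 2 +
      ((⟪z, b.repr.symm (WithLp.toLp 2 v)⟫_ℝ : ℝ) : ℂ) * Complex.I =
    -∑ i, (w i : ℂ) * (v i : ℂ) ^ 2 + ∑ i, (⟪b i, z⟫_ℝ * Complex.I) * v i := by
  have h1 : ∀ i, ⟪b i, b.repr.symm (WithLp.toLp 2 v)⟫_ℝ = v i := fun i => by
    rw [← b.repr_apply_apply, LinearIsometryEquiv.apply_symm_apply]
  have h2 : ⟪z, b.repr.symm (WithLp.toLp 2 v)⟫_ℝ = ∑ i, ⟪b i, z⟫_ℝ * v i := by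
    rw [← b.sum_inner_mul_inner]
    simp_rw [h1, real_inner_comm]
  simp_rw [h1]
  rw [h2]
  push_cast
  rw [Finset.sum_mul]
  congr 1
  exact Finset.sum_congr rfl fun i _ => by ring

theorem integrable_cexp_anisotropic {w : Fin n → ℝ} (hw : ∀ i, 0 < w i)
    (z : EuclideanSpace ℝ (Fin n)) :
    Integrable (fun ξ : EuclideanSpace ℝ (Fin n) =>
      Complex.exp (-∑ i, (w i : ℂ) * ((⟪b i, ξ⟫_ℝ : ℝ) : ℂ) ^ 2 +
        ((⟪z, ξ⟫_ℝ : ℝ) : ℂ) * Complex.I)) := by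
  rw [← b.measurePreserving_symm_toLp.integrable_comp_emb b.measurableEmbedding_symm_toLp]
  simp only [Function.comp_def, gaussian_comp_symm_toLp]
  exact GaussianFourier.integrable_cexp_neg_sum_mul_add (b := fun i => (w i : ℂ))
    (fun i => by simpa using hw i) _

/-- The Fourier transform of an anisotropic Gaussian. -/
theorem integral_cexp_anisotropic {w : Fin n → ℝ} (hw : ∀ i, 0 < w i)
    (z : EuclideanSpace ℝ (Fin n)) :
    ∫ ξ : EuclideanSpace ℝ (Fin n), Complex.exp (-∑ i, (w i : ℂ) * ((⟪b i, ξ⟫_ℝ : ℝ) : ℂ) ^ 2 +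
        ((⟪z, ξ⟫_ℝ : ℝ) : ℂ) * Complex.I) =
      (((∏ i, (Real.pi / w i) ^ (1 / 2 : ℝ)) *
        Real.exp (-∑ i, ⟪b i, z⟫_ℝ ^ 2 / (4 * w i)) : ℝ) : ℂ) := by
  rw [← b.measurePreserving_symm_toLp.integral_comp b.measurableEmbedding_symm_toLp]
  simp only [gaussian_comp_symm_toLp]
  rw [GaussianFourier.integral_cexp_neg_sum_mul_add (b := fun i => (w i : ℂ))
    (fun i => by simpa using hw i), Finset.prod_mul_distrib, ← Complex.exp_sum]
  push_cast
  congr 1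
  · refine Finset.prod_congr rfl fun i _ => ?_
    rw [Complex.ofReal_cpow (div_nonneg Real.pi_pos.le (hw i).le)]
    push_cast
    rfl
  · rw [← Finset.sum_neg_distrib]
    refine congrArg Complex.exp (Finset.sum_congr rfl fun i _ => ?_)
    rw [mul_pow, Complex.I_sq]
    ring

end Gaussian

/-- The law of the difference of two independent variables with law `μ`. -/
noncomputable def differenceMeasure {E : Type*} [AddGroup E] [MeasurableSpace E]
    (μ : Measure E) : Measure E := (μ.prod μ).map fun p => p.1 - p.2

section Parseval

variable {n : ℕ} {μ : Measure (EuclideanSpace ℝ (Fin n))} [IsProbabilityMeasure μ]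

instance : IsProbabilityMeasure (differenceMeasure μ) :=
  Measure.isProbabilityMeasure_map (by fun_prop)

theorem charFun_differenceMeasure (ξ : EuclideanSpace ℝ (Fin n)) :
    charFun (differenceMeasure μ) ξ = ((‖charFun μ ξ‖ ^ 2 : ℝ) : ℂ) := by
  rw [differenceMeasure, charFun_apply, integral_map (by fun_prop) (by fun_prop)]
  have h : ∀ p : EuclideanSpace ℝ (Fin n) × EuclideanSpace ℝ (Fin n),
      Complex.exp (⟪p.1 - p.2, ξ⟫_ℝ * Complex.I) =
        Complex.exp (⟪p.1, ξ⟫_ℝ * Complex.I) * Complex.exp (⟪p.2, -ξ⟫_ℝ * Complex.I) := by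
    intro p
    rw [← Complex.exp_add, inner_sub_left, inner_neg_right]
    push_cast
    ring_nf
  simp_rw [h]
  rw [integral_prod_mul (fun x => Complex.exp (⟪x, ξ⟫_ℝ * Complex.I))
    (fun x => Complex.exp (⟪x, -ξ⟫_ℝ * Complex.I)), ← charFun_apply, ← charFun_apply,
    charFun_neg, Complex.mul_conj]
  rw [Complex.normSq_eq_norm_sq]

theorem lintegral_mul_charFun_sq {g h : EuclideanSpace ℝ (Fin n) → ℝ} (hg0 : ∀ ξ, 0 ≤ g ξ)
    (hg : Integrable g) (hh0 : ∀ z, 0 ≤ h z)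
    (hgh : ∀ z, ∫ ξ, (g ξ : ℂ) * Complex.exp (⟪z, ξ⟫_ℝ * Complex.I) = (h z : ℂ)) :
    ∫⁻ ξ, ENNReal.ofReal (g ξ) * ENNReal.ofReal (‖charFun μ ξ‖ ^ 2) =
      ∫⁻ z, ENNReal.ofReal (h z) ∂(differenceMeasure μ) := by
  set ν := differenceMeasure μ
  have hint : Integrable (Function.uncurry fun (z ξ : EuclideanSpace ℝ (Fin n)) =>
      (g ξ : ℂ) * Complex.exp (⟪z, ξ⟫_ℝ * Complex.I)) (ν.prod volume) := by
    have h1 : Integrable (fun p : EuclideanSpace ℝ (Fin n) × EuclideanSpace ℝ (Fin n) =>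
        (g p.2 : ℂ)) (ν.prod volume) := (hg.comp_snd ν).ofReal
    refine h1.mono (h1.aestronglyMeasurable.mul (by fun_prop)) (ae_of_all _ fun p => ?_)
    simp [Function.uncurry, Complex.norm_exp_ofReal_mul_I]
  have hh : Integrable h ν := by
    have h1 := hint.integral_prod_left
    simp only [Function.uncurry] at h1
    simp_rw [hgh] at h1
    simpa using h1.re
  have hgM : Integrable fun ξ => g ξ * ‖charFun μ ξ‖ ^ 2 := by
    have h1 := hint.integral_prod_right
    simp only [Function.uncurry, integral_const_mul] at h1
    simp_rw [← charFun_apply] at h1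
    simp_rw [ν, charFun_differenceMeasure, ← Complex.ofReal_mul] at h1
    simpa only [RCLike.re_eq_complex_re, Complex.ofReal_re] using h1.re
  simp_rw [← ENNReal.ofReal_mul (hg0 _)]
  rw [← ofReal_integral_eq_lintegral_ofReal hgM
    (ae_of_all _ fun ξ => mul_nonneg (hg0 ξ) (by positivity)),
    ← ofReal_integral_eq_lintegral_ofReal hh (ae_of_all _ hh0)]
  congr 1
  have h2 := integral_integral_swap hint
  simp only [integral_const_mul] at h2
  simp_rw [hgh, ← charFun_apply, ν, charFun_differenceMeasure, ← Complex.ofReal_mul] at h2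
  rw [integral_complex_ofReal, integral_complex_ofReal] at h2
  exact (Complex.ofReal_injective h2).symm

theorem lintegral_gaussian_mul_charFun_sq
    (b : OrthonormalBasis (Fin n) ℝ (EuclideanSpace ℝ (Fin n)))
    {w : Fin n → ℝ} (hw : ∀ i, 0 < w i) :
    ∫⁻ ξ, ENNReal.ofReal (Real.exp (-∑ i, w i * ⟪b i, ξ⟫_ℝ ^ 2)) *
        ENNReal.ofReal (‖charFun μ ξ‖ ^ 2) =
      ENNReal.ofReal (∏ i, (Real.pi / w i) ^ (1 / 2 : ℝ)) *
        ∫⁻ z, ENNReal.ofReal (Real.exp (-∑ i, ⟪b i, z⟫_ℝ ^ 2 / (4 * w i)))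
          ∂(differenceMeasure μ) := by
  have hpos : 0 ≤ ∏ i, (Real.pi / w i) ^ (1 / 2 : ℝ) :=
    Finset.prod_nonneg fun i _ => Real.rpow_nonneg (div_nonneg Real.pi_pos.le (hw i).le) _
  rw [lintegral_mul_charFun_sq (h := fun z => (∏ i, (Real.pi / w i) ^ (1 / 2 : ℝ)) *
        Real.exp (-∑ i, ⟪b i, z⟫_ℝ ^ 2 / (4 * w i))) (fun _ => (Real.exp_pos _).le) ?_
        (fun z => by positivity) fun z => ?_]
  · simp_rw [ENNReal.ofReal_mul hpos]
    rw [lintegral_const_mul _ (by fun_prop)]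
  · have := (integrable_cexp_anisotropic b hw 0).norm
    simpa [Complex.norm_exp, ← Complex.ofReal_pow, ← Complex.ofReal_mul, ← Complex.ofReal_sum]
      using this
  · rw [← integral_cexp_anisotropic b hw z]
    refine integral_congr_ae (ae_of_all _ fun ξ => ?_)
    simp [Complex.exp_add]

/-- Frequency-side form of an isotropic Gaussian energy. -/
theorem lintegral_isotropic_gaussian_mul_charFun_sq {t : ℝ} (ht : 0 < t) :
    ∫⁻ ξ, ENNReal.ofReal (Real.exp (-(t * ‖ξ‖ ^ 2))) * ENNReal.ofReal (‖charFun μ ξ‖ ^ 2) =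
      ENNReal.ofReal (((Real.pi / t) ^ (1 / 2 : ℝ)) ^ n) *
        ∫⁻ z, ENNReal.ofReal (Real.exp (-(‖z‖ ^ 2 / (4 * t)))) ∂(differenceMeasure μ) := by
  have h := lintegral_gaussian_mul_charFun_sq (μ := μ) (EuclideanSpace.basisFun (Fin n) ℝ)
    (w := fun _ => t) fun _ => ht
  simp_rw [← Finset.mul_sum, ← Finset.sum_div, OrthonormalBasis.sum_sq_inner_right] at h
  simpa only [Finset.prod_const, Finset.card_univ, Fintype.card_fin] using h

theorem exists_orthonormalBasis_of_mem_grassmannian {ℓ : ℕ}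
    {P : EuclideanSpace ℝ (Fin n) →L[ℝ] EuclideanSpace ℝ (Fin n)} (hP : P ∈ grassmannian n ℓ) :
    ∃ (b : OrthonormalBasis (Fin n) ℝ (EuclideanSpace ℝ (Fin n))) (S : Finset (Fin n)),
      S.card = ℓ ∧ ∀ i, P (b i) = if i ∈ S then b i else 0 := by
  have hsym : P.toLinearMap.IsSymmetric := hP.2.1
  have hn : Module.finrank ℝ (EuclideanSpace ℝ (Fin n)) = n := by simp
  set b := hsym.eigenvectorBasis hn with hb
  have hPb : ∀ i, P (b i) = hsym.eigenvalues hn i • b i := hsym.apply_eigenvectorBasis hn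
  have hval : ∀ i, hsym.eigenvalues hn i = 0 ∨ hsym.eigenvalues hn i = 1 := by
    intro i
    have h1 := grassmannian_apply_apply hP (b i)
    rw [hPb, map_smul, hPb, smul_smul] at h1
    have h2 := smul_left_injective ℝ (b.orthonormal.ne_zero i) h1
    rcases eq_or_ne (hsym.eigenvalues hn i) 0 with h | h
    · exact Or.inl h
    · exact Or.inr (mul_left_cancel₀ h (by simpa using h2))
  classical
  refine ⟨b, Finset.univ.filter fun i => hsym.eigenvalues hn i = 1, ?_, fun i => ?_⟩
  · have hproj : LinearMap.IsProj (LinearMap.range P.toLinearMap) P.toLinearMap :=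
      ⟨fun x => ⟨x, rfl⟩, by rintro _ ⟨y, rfl⟩; exact grassmannian_apply_apply hP y⟩
    have h1 := hproj.trace
    rw [hP.2.2, hsym.trace_eq_sum_eigenvalues hn] at h1
    have h2 : ∀ i, hsym.eigenvalues hn i = if hsym.eigenvalues hn i = 1 then 1 else 0 := by
      intro i
      rcases hval i with h | h <;> simp [h]
    have h3 : ((Finset.univ.filter fun i => hsym.eigenvalues hn i = 1).card : ℝ) = ℓ := by
      rw [← h1, Finset.card_filter]
      push_cast
      exact Finset.sum_congr rfl fun i _ => (h2 i).symm
    exact_mod_cast h3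
  · rcases hval i with h | h <;> simp [hPb, h]

/-- Gaussian energy of a projected measure, bounded on the frequency side. -/
theorem lintegral_projection_gaussian_le {ℓ : ℕ}
    {P : EuclideanSpace ℝ (Fin n) →L[ℝ] EuclideanSpace ℝ (Fin n)} (hP : P ∈ grassmannian n ℓ)
    {r : ℝ} (hr : 0 < r) :
    ∫⁻ z, ENNReal.ofReal (Real.exp (-(‖P z‖ ^ 2 / r ^ 2 + ‖z - P z‖ ^ 2)))
        ∂(differenceMeasure μ) ≤
      ENNReal.ofReal (r ^ ℓ) *
        ∫⁻ ξ, ENNReal.ofReal (Real.exp (-((r ^ 2 * ‖P ξ‖ ^ 2 + ‖ξ - P ξ‖ ^ 2) / 4))) *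
          ENNReal.ofReal (‖charFun μ ξ‖ ^ 2) := by
  obtain ⟨b, S, hS, hPb⟩ := exists_orthonormalBasis_of_mem_grassmannian hP
  have hin : ∀ i v, ⟪b i, P v⟫_ℝ = if i ∈ S then ⟪b i, v⟫_ℝ else 0 := by
    intro i v
    rw [← hP.2.1, hPb]
    split_ifs <;> simp
  have hn1 : ∀ v, ‖P v‖ ^ 2 = ∑ i, if i ∈ S then ⟪b i, v⟫_ℝ ^ 2 else 0 := by
    intro v
    rw [← b.sum_sq_inner_right]
    refine Finset.sum_congr rfl fun i _ => ?_
    rw [hin]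
    split_ifs <;> simp
  have hn2 : ∀ v, ‖v - P v‖ ^ 2 = ∑ i, if i ∈ S then 0 else ⟪b i, v⟫_ℝ ^ 2 := by
    intro v
    rw [← b.sum_sq_inner_right]
    refine Finset.sum_congr rfl fun i _ => ?_
    rw [inner_sub_right, hin]
    split_ifs <;> simp
  have h := lintegral_gaussian_mul_charFun_sq (μ := μ) b
    (w := fun i => if i ∈ S then r ^ 2 / 4 else 1 / 4) fun i => by split_ifs <;> positivity
  have e1 : ∀ ξ, ∑ i, (if i ∈ S then r ^ 2 / 4 else 1 / 4) * ⟪b i, ξ⟫_ℝ ^ 2 =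
      (r ^ 2 * ‖P ξ‖ ^ 2 + ‖ξ - P ξ‖ ^ 2) / 4 := by
    intro ξ
    rw [hn1, hn2, Finset.mul_sum, ← Finset.sum_add_distrib, Finset.sum_div]
    refine Finset.sum_congr rfl fun i _ => ?_
    split_ifs <;> ring
  have e2 : ∀ z, ∑ i, ⟪b i, z⟫_ℝ ^ 2 / (4 * (if i ∈ S then r ^ 2 / 4 else 1 / 4)) =
      ‖P z‖ ^ 2 / r ^ 2 + ‖z - P z‖ ^ 2 := by
    intro z
    rw [hn1, hn2, Finset.sum_div, ← Finset.sum_add_distrib]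
    refine Finset.sum_congr rfl fun i _ => ?_
    split_ifs <;> field_simp <;> ring
  simp_rw [e1, e2] at h
  rw [h, ← mul_assoc, ← ENNReal.ofReal_mul (by positivity)]
  refine le_mul_of_one_le_left zero_le ?_
  rw [ENNReal.one_le_ofReal]
  have h4 : (1 : ℝ) ≤ (4 * Real.pi) ^ (1 / 2 : ℝ) :=
    Real.one_le_rpow (by linarith [Real.pi_gt_three]) (by norm_num)
  have h5 : ∏ i, (if i ∈ S then r⁻¹ else 1) ≤
      ∏ i, (Real.pi / (if i ∈ S then r ^ 2 / 4 else 1 / 4)) ^ (1 / 2 : ℝ) := by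
    refine Finset.prod_le_prod (fun i _ => by split_ifs <;> positivity) fun i _ => ?_
    split_ifs
    · have : Real.pi / (r ^ 2 / 4) = (4 * Real.pi) * (r⁻¹) ^ 2 := by field_simp
      rw [this, Real.mul_rpow (by positivity) (by positivity), ← Real.rpow_natCast,
        ← Real.rpow_mul (by positivity)]
      norm_num
      have : 0 < r⁻¹ := by positivity
      norm_num at h4
      nlinarith
    · have : Real.pi / (1 / 4) = 4 * Real.pi := by ring
      rw [this]; exact h4
  have h6 : r ^ ℓ * ∏ i, (if i ∈ S then r⁻¹ else 1) = 1 := by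
    rw [Finset.prod_ite_mem, Finset.univ_inter, Finset.prod_const, hS, ← mul_pow,
      mul_inv_cancel₀ hr.ne', one_pow]
  exact h6.ge.trans (by gcongr)

end Parseval

section Energy

variable {n : ℕ} {μ : Measure (EuclideanSpace ℝ (Fin n))} [IsProbabilityMeasure μ]
  {s C : ℝ}

theorem differenceMeasure_ball_le
    (hμ : ∀ x, ∀ r : ℝ, 0 < r → μ (ball x r) ≤ ENNReal.ofReal (C * r ^ s)) {r : ℝ} (hr : 0 < r) :
    differenceMeasure μ {z | ‖z‖ < r} ≤ ENNReal.ofReal (C * r ^ s) := by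
  have hm : MeasurableSet {z : EuclideanSpace ℝ (Fin n) | ‖z‖ < r} :=
    measurableSet_lt measurable_norm measurable_const
  rw [differenceMeasure, Measure.map_apply (by fun_prop) hm,
    Measure.prod_apply ((by fun_prop : Measurable fun p : EuclideanSpace ℝ (Fin n) ×
      EuclideanSpace ℝ (Fin n) => p.1 - p.2) hm)]
  refine (lintegral_mono (g := fun _ => ENNReal.ofReal (C * r ^ s)) fun x => ?_).trans (by simp)
  refine le_trans (measure_mono fun y hy => ?_) (hμ x r hr)
  simpa [dist_eq_norm, norm_sub_rev] using hy

/-- Spherical energies of a Frostman measure are finite. -/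
theorem lintegral_rpow_mul_charFun_sq_lt_top (hs : 0 ≤ s) (hC : 0 ≤ C)
    (hμ : ∀ x, ∀ r : ℝ, 0 < r → μ (ball x r) ≤ ENNReal.ofReal (C * r ^ s)) {p : ℝ} (hp : 0 ≤ p)
    (hnp : n - s < p) :
    ∫⁻ ξ : EuclideanSpace ℝ (Fin n), ENNReal.ofReal ((1 + ‖ξ‖) ^ (-p)) *
      ENNReal.ofReal (‖charFun μ ξ‖ ^ 2) < ⊤ := by
  set B : ℝ := 2 * Real.exp (2 * (s + 1) ^ 2) * 2 ^ s
  have hpt : ∀ ξ : EuclideanSpace ℝ (Fin n), ENNReal.ofReal ((1 + ‖ξ‖) ^ (-p)) ≤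
      ∑' k : ℕ, ENNReal.ofReal (Real.exp 8 * ((2 : ℝ) ^ k) ^ (-p)) *
        ENNReal.ofReal (Real.exp (-(2 / (2 ^ k) ^ 2 * ‖ξ‖ ^ 2))) := by
    intro ξ
    obtain ⟨k, hk1, hk2⟩ := exists_nat_pow_near (x := 1 + ‖ξ‖) (y := (2 : ℝ))
      (by linarith [norm_nonneg ξ]) (by norm_num)
    refine le_trans ?_ (ENNReal.le_tsum k)
    rw [← ENNReal.ofReal_mul (by positivity)]
    refine ENNReal.ofReal_le_ofReal ?_
    have h1 : ‖ξ‖ ≤ 2 * 2 ^ k := by rw [pow_succ] at hk2; linarith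
    have h2 : 2 / ((2 : ℝ) ^ k) ^ 2 * ‖ξ‖ ^ 2 ≤ 8 := by
      rw [div_mul_eq_mul_div, div_le_iff₀ (by positivity)]
      nlinarith [norm_nonneg ξ]
    have h3 : 1 ≤ Real.exp 8 * Real.exp (-(2 / ((2 : ℝ) ^ k) ^ 2 * ‖ξ‖ ^ 2)) := by
      rw [← Real.exp_add]
      exact Real.one_le_exp (by linarith)
    have h4 : (1 + ‖ξ‖) ^ (-p) ≤ ((2 : ℝ) ^ k) ^ (-p) :=
      Real.rpow_le_rpow_of_nonpos (by positivity) hk1 (by linarith)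
    have h5 : 0 ≤ ((2 : ℝ) ^ k) ^ (-p) := by positivity
    nlinarith
  have hgauss : ∀ k : ℕ, ∫⁻ ξ : EuclideanSpace ℝ (Fin n),
      ENNReal.ofReal (Real.exp (-(2 / (2 ^ k) ^ 2 * ‖ξ‖ ^ 2))) *
        ENNReal.ofReal (‖charFun μ ξ‖ ^ 2) ≤
      ENNReal.ofReal (((Real.pi / 2) ^ (1 / 2 : ℝ) * 2 ^ k) ^ n * (B * (C * (2 ^ k) ^ (-s)))) := by
    intro k
    have h2k : (0 : ℝ) < 2 ^ k := by positivity
    rw [lintegral_isotropic_gaussian_mul_charFun_sq (by positivity),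
      ENNReal.ofReal_mul (by positivity)]
    refine mul_le_mul' (le_of_eq ?_) ?_
    · congr 2
      have : Real.pi / (2 / (2 ^ k) ^ 2) = Real.pi / 2 * (2 ^ k) ^ 2 := by field_simp
      rw [this, Real.mul_rpow (by positivity) (by positivity), ← Real.rpow_natCast (2 ^ k) 2,
        ← Real.rpow_mul (by positivity)]
      norm_num
    · refine le_trans (le_of_eq ?_) (lintegral_exp_neg_sq_le
        (ν := differenceMeasure μ) (f := fun z : EuclideanSpace ℝ (Fin n) => 2 ^ k * ‖z‖) (s := s)
        (D := C * (2 ^ k) ^ (-s)) (by fun_prop) (fun _ => by positivity) hs (by positivity)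
        fun u hu => ?_)
      · congr 1
        ext z
        congr 3
        field_simp
        ring
      · have hu0 : 0 < u := by linarith
        have h1 := differenceMeasure_ball_le hμ (r := u / 2 ^ k) (by positivity)
        rw [Real.div_rpow hu0.le h2k.le, div_eq_mul_inv (u ^ s),
          ← Real.rpow_neg h2k.le] at h1
        refine le_trans (measure_mono fun z hz => ?_) (h1.trans (le_of_eq ?_))
        · show ‖z‖ < u / 2 ^ k
          rw [lt_div_iff₀ h2k, mul_comm]
          exact hz
        · congr 1; ring
  set q : ℝ := 2 ^ (n - s - p)
  have hq : q < 1 := Real.rpow_lt_one_of_one_lt_of_neg (by norm_num) (by linarith)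
  have hq0 : 0 ≤ q := by positivity
  set L : ℝ := Real.exp 8 * ((Real.pi / 2) ^ (1 / 2 : ℝ)) ^ n * (B * C)
  have hterm : ∀ k : ℕ, Real.exp 8 * ((2 : ℝ) ^ k) ^ (-p) *
      (((Real.pi / 2) ^ (1 / 2 : ℝ) * 2 ^ k) ^ n * (B * (C * (2 ^ k) ^ (-s)))) = L * q ^ k := by
    intro k
    have h1 : q ^ k = (2 ^ k) ^ n * (2 ^ k) ^ (-s) * (2 ^ k) ^ (-p) := by
      rw [← Real.rpow_natCast (2 ^ k) n, ← Real.rpow_add (by positivity),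
        ← Real.rpow_add (by positivity), ← Real.rpow_natCast, ← Real.rpow_natCast,
        ← Real.rpow_mul (by norm_num), ← Real.rpow_mul (by norm_num)]
      congr 1
      ring
    rw [h1, mul_pow]
    ring
  calc _ ≤ ∫⁻ ξ : EuclideanSpace ℝ (Fin n), ∑' k : ℕ,
        ENNReal.ofReal (Real.exp 8 * ((2 : ℝ) ^ k) ^ (-p)) *
        (ENNReal.ofReal (Real.exp (-(2 / (2 ^ k) ^ 2 * ‖ξ‖ ^ 2))) *
          ENNReal.ofReal (‖charFun μ ξ‖ ^ 2)) := by
        refine lintegral_mono fun ξ => ?_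
        simp_rw [← mul_assoc]
        rw [ENNReal.tsum_mul_right]
        exact mul_le_mul_left (hpt ξ) _
    _ = ∑' k : ℕ, ENNReal.ofReal (Real.exp 8 * ((2 : ℝ) ^ k) ^ (-p)) *
        ∫⁻ ξ : EuclideanSpace ℝ (Fin n), ENNReal.ofReal (Real.exp (-(2 / (2 ^ k) ^ 2 * ‖ξ‖ ^ 2))) *
          ENNReal.ofReal (‖charFun μ ξ‖ ^ 2) := by
        rw [lintegral_tsum fun k => by fun_prop]
        congr 1
        ext k
        rw [lintegral_const_mul _ (by fun_prop)]
    _ ≤ ∑' k : ℕ, ENNReal.ofReal (L * q ^ k) := by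
        refine ENNReal.tsum_le_tsum fun k => ?_
        rw [← hterm, ENNReal.ofReal_mul (p := Real.exp 8 * _) (by positivity)]
        gcongr
        exact hgauss k
    _ = ENNReal.ofReal (∑' k : ℕ, L * q ^ k) :=
        (ENNReal.ofReal_tsum_of_nonneg (fun k => by positivity)
          ((summable_geometric_of_lt_one hq0 hq).mul_left _)).symm
    _ < ⊤ := ENNReal.ofReal_lt_top

end Energy

section

variable {n m : ℕ} {β c : ℝ}
  {lam : Measure (EuclideanSpace ℝ (Fin n) →L[ℝ] EuclideanSpace ℝ (Fin n))}
  {μ : Measure (EuclideanSpace ℝ (Fin n))} [IsProbabilityMeasure μ] {s C : ℝ}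

theorem exp_neg_anisotropic_le {ℓ : ℕ} {a : ℝ} (ha : 0 ≤ a)
    {P : EuclideanSpace ℝ (Fin n) →L[ℝ] EuclideanSpace ℝ (Fin n)} (hP : P ∈ grassmannian n ℓ)
    {r : ℝ} (hr : 0 < r) (hr1 : r ≤ 1) (ξ : EuclideanSpace ℝ (Fin n)) :
    Real.exp (-((r ^ 2 * ‖P ξ‖ ^ 2 + ‖ξ - P ξ‖ ^ 2) / 4)) ≤
      Real.exp (2 * a ^ 2) * r ^ (-a) * (1 + ‖ξ‖) ^ (-a) * Real.exp (-(‖ξ - P ξ‖ ^ 2 / 8)) := by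
  have h1 := norm_sq_eq_of_mem_grassmannian hP ξ
  have h2 : Real.exp (-((r ^ 2 * ‖P ξ‖ ^ 2 + ‖ξ - P ξ‖ ^ 2) / 4)) ≤
      Real.exp (-((r * ‖ξ‖) ^ 2 / 8)) * Real.exp (-(‖ξ - P ξ‖ ^ 2 / 8)) := by
    rw [← Real.exp_add, Real.exp_le_exp, mul_pow, h1]
    have h3 : r ^ 2 ≤ 1 := pow_le_one₀ hr.le hr1
    nlinarith [mul_nonneg (sq_nonneg r) (sq_nonneg ‖P ξ‖), sq_nonneg ‖ξ - P ξ‖,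
      mul_le_mul_of_nonneg_right h3 (sq_nonneg ‖ξ - P ξ‖)]
  refine h2.trans (mul_le_mul_of_nonneg_right ?_ (Real.exp_pos _).le)
  refine (exp_neg_sq_le_rpow ha (by positivity)).trans ?_
  rw [mul_assoc, ← Real.mul_rpow hr.le (by positivity)]
  refine mul_le_mul_of_nonneg_left ?_ (Real.exp_pos _).le
  exact Real.rpow_le_rpow_of_nonpos (by positivity) (by linarith) (by linarith)

/-- The averaged Gaussian energy of the projections of a Frostman measure. -/
theorem exists_lintegral_projection_gaussian_le (hc : 0 < c)
    (hG : lam (grassmannian n (m + 1))ᶜ = 0)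
    (hlam : ∀ P ∈ grassmannian n (m + 1), ∀ r : ℝ, 0 < r →
      lam (closedBall P r) ≤ ENNReal.ofReal (c * r ^ β))
    {τ : ℝ} (hτ : τ = β - m * (n - (m + 1) : ℕ)) (hs : 0 ≤ s) (hC : 0 ≤ C)
    (hμ : ∀ x, ∀ r : ℝ, 0 < r → μ (ball x r) ≤ ENNReal.ofReal (C * r ^ s))
    {R : ℝ} (hR : ∀ᵐ z ∂(differenceMeasure μ), ‖z‖ ≤ R) {a : ℝ} (ha : 0 ≤ a)
    (hp : 0 ≤ a + τ) (hnp : n - s < a + τ) :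
    ∃ M : ℝ≥0∞, M ≠ ⊤ ∧ ∀ r : ℝ, 0 < r → r ≤ 1 →
      ∫⁻ P, ∫⁻ z, ENNReal.ofReal (Real.exp (-(‖P z‖ ^ 2 / r ^ 2)))
        ∂(differenceMeasure μ) ∂lam ≤ ENNReal.ofReal (r ^ ((m + 1 : ℕ) - a)) * M := by
  obtain ⟨B, hB, hexp⟩ := exists_lintegral_exp_le hc hG hlam hτ
  have : IsFiniteMeasure lam :=
    ⟨(measure_univ_le_of_grassmannian hG hlam).trans_lt ENNReal.ofReal_lt_top⟩
  have : ProperSpace (EuclideanSpace ℝ (Fin n) →L[ℝ] EuclideanSpace ℝ (Fin n)) :=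
    FiniteDimensional.proper ℝ _
  set A : ℝ := Real.exp (2 * a ^ 2)
  set I : ℝ≥0∞ := ∫⁻ ξ : EuclideanSpace ℝ (Fin n), ENNReal.ofReal ((1 + ‖ξ‖) ^ (-(a + τ))) *
      ENNReal.ofReal (‖charFun μ ξ‖ ^ 2)
  have hI : I < ⊤ := lintegral_rpow_mul_charFun_sq_lt_top hs hC hμ hp hnp
  refine ⟨ENNReal.ofReal (Real.exp (R ^ 2)) * ENNReal.ofReal (A * B) * I, by finiteness,
    fun r hr hr1 => ?_⟩
  have hae : ∀ᵐ P ∂lam, P ∈ grassmannian n (m + 1) := mem_ae_iff.2 hG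
  have hfix : ∀ P ∈ grassmannian n (m + 1),
      ∫⁻ z, ENNReal.ofReal (Real.exp (-(‖P z‖ ^ 2 / r ^ 2))) ∂(differenceMeasure μ) ≤
        ENNReal.ofReal (Real.exp (R ^ 2)) * ENNReal.ofReal (r ^ (m + 1)) *
          (ENNReal.ofReal (A * r ^ (-a)) * ∫⁻ ξ, ENNReal.ofReal (Real.exp (-(‖ξ - P ξ‖ ^ 2 / 8))) *
            (ENNReal.ofReal ((1 + ‖ξ‖) ^ (-a)) * ENNReal.ofReal (‖charFun μ ξ‖ ^ 2))) := by
    intro P hP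
    calc _ ≤ ∫⁻ z, ENNReal.ofReal (Real.exp (R ^ 2)) * ENNReal.ofReal (Real.exp
          (-(‖P z‖ ^ 2 / r ^ 2 + ‖z - P z‖ ^ 2))) ∂(differenceMeasure μ) := by
          refine lintegral_mono_ae (hR.mono fun z hz => ?_)
          rw [← ENNReal.ofReal_mul (Real.exp_pos _).le, ← Real.exp_add]
          refine ENNReal.ofReal_le_ofReal (Real.exp_le_exp.2 ?_)
          have := norm_sub_apply_le_of_mem_grassmannian hP z
          have : ‖z - P z‖ ^ 2 ≤ R ^ 2 := by gcongr; linarith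
          linarith
      _ = ENNReal.ofReal (Real.exp (R ^ 2)) * ∫⁻ z, ENNReal.ofReal (Real.exp
          (-(‖P z‖ ^ 2 / r ^ 2 + ‖z - P z‖ ^ 2))) ∂(differenceMeasure μ) :=
          lintegral_const_mul _ (by fun_prop)
      _ ≤ _ := by
          rw [mul_assoc]
          gcongr
          refine (lintegral_projection_gaussian_le hP hr).trans ?_
          gcongr
          rw [← lintegral_const_mul _ (by fun_prop)]
          refine lintegral_mono fun ξ => ?_
          simp only [← mul_assoc]
          gcongr
          rw [← ENNReal.ofReal_mul (by positivity), ← ENNReal.ofReal_mul (by positivity)]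
          refine ENNReal.ofReal_le_ofReal ((exp_neg_anisotropic_le ha hP hr hr1 ξ).trans
            (le_of_eq ?_))
          ring
  have hmeas : Measurable fun q : (EuclideanSpace ℝ (Fin n) →L[ℝ] EuclideanSpace ℝ (Fin n)) ×
      EuclideanSpace ℝ (Fin n) => ENNReal.ofReal (Real.exp (-(‖q.2 - q.1 q.2‖ ^ 2 / 8))) *
        (ENNReal.ofReal ((1 + ‖q.2‖) ^ (-a)) * ENNReal.ofReal (‖charFun μ q.2‖ ^ 2)) := by
    have h1 : Measurable fun q : (EuclideanSpace ℝ (Fin n) →L[ℝ] EuclideanSpace ℝ (Fin n)) ×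
        EuclideanSpace ℝ (Fin n) => q.2 - q.1 q.2 :=
      Continuous.measurable (by fun_prop)
    fun_prop
  calc _ ≤ ∫⁻ P, ENNReal.ofReal (Real.exp (R ^ 2)) * ENNReal.ofReal (r ^ (m + 1)) *
          (ENNReal.ofReal (A * r ^ (-a)) * ∫⁻ ξ, ENNReal.ofReal (Real.exp (-(‖ξ - P ξ‖ ^ 2 / 8))) *
            (ENNReal.ofReal ((1 + ‖ξ‖) ^ (-a)) * ENNReal.ofReal (‖charFun μ ξ‖ ^ 2))) ∂lam :=
        lintegral_mono_ae (hae.mono hfix)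
    _ = ENNReal.ofReal (Real.exp (R ^ 2)) * ENNReal.ofReal (r ^ (m + 1)) *
          (ENNReal.ofReal (A * r ^ (-a)) *
            ∫⁻ ξ, (∫⁻ P, ENNReal.ofReal (Real.exp (-(‖ξ - P ξ‖ ^ 2 / 8))) ∂lam) *
            (ENNReal.ofReal ((1 + ‖ξ‖) ^ (-a)) * ENNReal.ofReal (‖charFun μ ξ‖ ^ 2))) := by
        have h1 := hmeas.lintegral_prod_right' (ν := (volume : Measure (EuclideanSpace ℝ (Fin n))))
        simp only at h1
        rw [lintegral_const_mul _ (h1.const_mul _), lintegral_const_mul _ h1,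
          lintegral_lintegral_swap hmeas.aemeasurable]
        congr 3
        ext ξ
        rw [lintegral_mul_const _ (by fun_prop)]
    _ ≤ ENNReal.ofReal (Real.exp (R ^ 2)) * ENNReal.ofReal (r ^ (m + 1)) *
          (ENNReal.ofReal (A * r ^ (-a)) * (ENNReal.ofReal B * I)) := by
        gcongr
        rw [← lintegral_const_mul _ (by fun_prop)]
        refine lintegral_mono fun ξ => ?_
        simp only [← mul_assoc]
        refine mul_le_mul_left ?_ _
        refine (mul_le_mul_left (hexp ξ) _).trans (le_of_eq ?_)
        rw [← ENNReal.ofReal_mul (by positivity), ← ENNReal.ofReal_mul (by positivity), mul_assoc,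
          ← Real.rpow_add (by positivity), ← neg_add_rev]
    _ = _ := by
        have h1 : r ^ (((m + 1 : ℕ) : ℝ) - a) = r ^ (m + 1) * r ^ (-a) := by
          rw [sub_eq_add_neg, Real.rpow_add hr, Real.rpow_natCast]
        rw [h1, ENNReal.ofReal_mul (by positivity), ENNReal.ofReal_mul (by positivity),
          ENNReal.ofReal_mul (by positivity)]
        ring

end

/-- Mass distribution principle for images. -/
theorem hausdorffMeasure_image_ne_zero {X Y : Type*} [MeasurableSpace X] [MetricSpace Y]
    [MeasurableSpace Y] [BorelSpace Y] {f : X → Y} (hf : Measurable f) {μ : Measure X}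
    {F A : Set X} (hFA : F ⊆ A) (hF : μ F ≠ 0) {σ N : ℝ} (hσ : 0 < σ) (hN : 0 < N)
    (h : ∀ x ∈ F, ∀ k : ℕ, μ {y | dist (f x) (f y) ≤ (1 / 2) ^ k} ≤
      ENNReal.ofReal (N * ((1 / 2) ^ k) ^ σ)) :
    μH[σ] (f '' A) ≠ 0 := by
  set ν : Measure Y := (μ.restrict F).map f
  have hν : ∀ (s : Set Y) (k : ℕ), ediam s ≤ ENNReal.ofReal ((1 / 2) ^ k) →
      ν s ≤ ENNReal.ofReal (N * ((1 / 2) ^ k) ^ σ) := by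
    intro s k hs
    refine (measure_mono subset_closure).trans ?_
    have hcl : MeasurableSet (closure s) := isClosed_closure.measurableSet
    rw [Measure.map_apply hf hcl, Measure.restrict_apply (hf hcl)]
    rcases (f ⁻¹' closure s ∩ F).eq_empty_or_nonempty with he | ⟨x, hxs, hxF⟩
    · simp [he]
    refine (measure_mono fun y hy => ?_).trans (h x hxF k)
    have hx' : f x ∈ closure s := hxs
    have hy' : f y ∈ closure s := hy.1
    have h1 := (edist_le_ediam_of_mem hx' hy').trans ((ediam_closure s).le.trans hs)
    rw [edist_dist] at h1
    exact (ENNReal.ofReal_le_ofReal_iff (by positivity)).1 h1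
  set D : ℝ≥0∞ := ENNReal.ofReal (N * 2 ^ σ)
  have hD0 : D ≠ 0 := by simp only [D, ne_eq, ENNReal.ofReal_eq_zero, not_le]; positivity
  have hle : D⁻¹ • ν ≤ μH[σ] := by
    refine Measure.le_hausdorffMeasure σ _ 1 one_pos fun s hs => ?_
    rw [Measure.smul_apply, smul_eq_mul]
    rw [ENNReal.inv_mul_le_iff hD0 ENNReal.ofReal_ne_top]
    set δ : ℝ := (ediam s).toReal
    have hδ : ediam s = ENNReal.ofReal δ :=
      (ENNReal.ofReal_toReal (ne_top_of_le_ne_top ENNReal.one_ne_top hs)).symm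
    have hδ0 : 0 ≤ δ := ENNReal.toReal_nonneg
    have hδ1 : δ ≤ 1 := by
      rw [hδ, ← ENNReal.ofReal_one] at hs
      exact (ENNReal.ofReal_le_ofReal_iff zero_le_one).1 hs
    rcases hδ0.eq_or_lt with h0 | hpos
    · have h1 : ∀ k : ℕ, ν s ≤ ENNReal.ofReal (N * ((1 / 2) ^ σ) ^ k) := by
        intro k
        refine (hν s k (by rw [hδ, ← h0]; simp)).trans (le_of_eq ?_)
        rw [← Real.rpow_natCast, ← Real.rpow_natCast, ← Real.rpow_mul (by norm_num),
          ← Real.rpow_mul (by norm_num), mul_comm (k : ℝ)]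
      have h2 : Filter.Tendsto (fun k : ℕ => ENNReal.ofReal (N * ((1 / 2 : ℝ) ^ σ) ^ k))
          Filter.atTop (nhds 0) := by
        rw [← ENNReal.ofReal_zero]
        refine ENNReal.tendsto_ofReal ?_
        rw [← mul_zero N]
        exact (tendsto_pow_atTop_nhds_zero_of_lt_one (by positivity)
          (Real.rpow_lt_one (by norm_num) (by norm_num) hσ)).const_mul N
      exact (ge_of_tendsto' h2 h1).trans zero_le
    · obtain ⟨k, hk1, hk2⟩ := exists_nat_pow_near_of_lt_one hpos hδ1
        (by norm_num : (0 : ℝ) < 1 / 2) (by norm_num)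
      refine (hν s k (by rw [hδ]; exact ENNReal.ofReal_le_ofReal hk2)).trans ?_
      rw [hδ, ENNReal.ofReal_rpow_of_pos hpos, ← ENNReal.ofReal_mul (by positivity)]
      refine ENNReal.ofReal_le_ofReal ?_
      rw [mul_assoc, ← Real.mul_rpow (by norm_num) hδ0]
      gcongr
      rw [pow_succ] at hk1
      linarith
  intro h0
  have h1 := hle (f '' A)
  rw [h0, Measure.smul_apply, smul_eq_mul, nonpos_iff_eq_zero, mul_eq_zero] at h1
  rcases h1 with h1 | h1
  · exact ENNReal.ofReal_ne_top (ENNReal.inv_eq_zero.1 h1)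
  · have h2 : (μ.restrict F) (f ⁻¹' (f '' A)) ≤ 0 :=
      (Measure.le_map_apply hf.aemeasurable _).trans h1.le
    refine hF (le_antisymm ((le_trans ?_ h2)) zero_le)
    rw [← Measure.restrict_apply_self μ F]
    exact measure_mono (hFA.trans (subset_preimage_image f A))

section

variable {n m : ℕ} {β c : ℝ}
  {lam : Measure (EuclideanSpace ℝ (Fin n) →L[ℝ] EuclideanSpace ℝ (Fin n))}
  {μ : Measure (EuclideanSpace ℝ (Fin n))} [IsProbabilityMeasure μ] {s C : ℝ}

theorem lintegral_differenceMeasure {g : EuclideanSpace ℝ (Fin n) → ℝ≥0∞} (hg : Measurable g) :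
    ∫⁻ z, g z ∂(differenceMeasure μ) = ∫⁻ x, ∫⁻ y, g (x - y) ∂μ ∂μ := by
  rw [differenceMeasure, lintegral_map hg (by fun_prop), lintegral_prod _ (by fun_prop)]

theorem hausdorffMeasure_image_ne_zero_of_energy
    {P : EuclideanSpace ℝ (Fin n) →L[ℝ] EuclideanSpace ℝ (Fin n)} {σ : ℝ} (hσ : 0 < σ)
    (h : ∑' k : ℕ, ENNReal.ofReal ((2 ^ k) ^ σ) * ∫⁻ z, ENNReal.ofReal
      (Real.exp (-(‖P z‖ ^ 2 / ((1 / 2) ^ k) ^ 2))) ∂(differenceMeasure μ) ≠ ⊤)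
    {A : Set (EuclideanSpace ℝ (Fin n))} (hA : μ Aᶜ = 0) : μH[σ] (P '' A) ≠ 0 := by
  let g : ℕ → EuclideanSpace ℝ (Fin n) → ℝ≥0∞ := fun k x => ENNReal.ofReal ((2 ^ k) ^ σ) *
    ∫⁻ y, ENNReal.ofReal (Real.exp (-(‖P (x - y)‖ ^ 2 / ((1 / 2) ^ k) ^ 2))) ∂μ
  have hm : ∀ k : ℕ, Measurable fun x => ∫⁻ y, ENNReal.ofReal
      (Real.exp (-(‖P (x - y)‖ ^ 2 / ((1 / 2) ^ k) ^ 2))) ∂μ := fun k =>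
    Measurable.lintegral_prod_right' (f := fun p : EuclideanSpace ℝ (Fin n) ×
      EuclideanSpace ℝ (Fin n) => ENNReal.ofReal
      (Real.exp (-(‖P (p.1 - p.2)‖ ^ 2 / ((1 / 2) ^ k) ^ 2)))) (by fun_prop)
  have hgm : ∀ k, Measurable (g k) := fun k => (hm k).const_mul _
  have hsum : ∫⁻ x, ∑' k, g k x ∂μ ≠ ⊤ := by
    rw [lintegral_tsum fun k => (hgm k).aemeasurable]
    convert h using 3 with k
    rw [lintegral_differenceMeasure (by fun_prop), lintegral_const_mul _ (hm k)]
  have hfin : ∀ᵐ x ∂μ, ∑' k, g k x < ⊤ :=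
    ae_lt_top (Measurable.tsum hgm) hsum
  have hAae : ∀ᵐ x ∂μ, x ∈ A := mem_ae_iff.2 hA
  have hcover : μ (⋃ N : ℕ, {x ∈ A | ∑' k, g k x ≤ N}) ≠ 0 := by
    have h1 : ∀ᵐ x ∂μ, x ∈ ⋃ N : ℕ, {x ∈ A | ∑' k, g k x ≤ N} := by
      filter_upwards [hfin, hAae] with x hx hxA
      obtain ⟨N, hN⟩ := ENNReal.exists_nat_gt hx.ne
      exact mem_iUnion.2 ⟨N, hxA, hN.le⟩
    exact ((measure_congr (Filter.eventuallyEq_univ.2 h1)).trans measure_univ).trans_ne one_ne_zero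
  obtain ⟨N, hN⟩ := exists_measure_pos_of_not_measure_iUnion_null hcover
  refine hausdorffMeasure_image_ne_zero (f := P) (F := {x ∈ A | ∑' k, g k x ≤ N})
    (N := Real.exp 1 * (N + 1)) P.continuous.measurable (fun x hx => hx.1) hN.ne' hσ
    (by positivity) fun x hx k => ?_
  have h1 : g k x ≤ N := (ENNReal.le_tsum k).trans hx.2
  set S := {y | dist (P x) (P y) ≤ (1 / 2) ^ k}
  have hSm : MeasurableSet S :=
    (isClosed_le (continuous_const.dist P.continuous) continuous_const).measurableSet
  have h2 : ENNReal.ofReal (Real.exp (-1)) * μ S ≤ ∫⁻ y, ENNReal.ofReal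
      (Real.exp (-(‖P (x - y)‖ ^ 2 / ((1 / 2) ^ k) ^ 2))) ∂μ := by
    rw [← lintegral_indicator_const hSm]
    refine lintegral_mono fun y => ?_
    by_cases hy : y ∈ S
    swap
    · rw [indicator_of_notMem hy]
      exact zero_le
    rw [indicator_of_mem hy]
    refine ENNReal.ofReal_le_ofReal (Real.exp_le_exp.2 (neg_le_neg ?_))
    rw [div_le_one (by positivity), map_sub, ← dist_eq_norm]
    gcongr
    exact hy
  have h3 : ENNReal.ofReal ((2 ^ k) ^ σ * Real.exp (-1)) * μ S ≤ N := by
    rw [ENNReal.ofReal_mul (by positivity), mul_assoc]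
    exact (mul_le_mul_right h2 _).trans h1
  have h4 : Real.exp 1 * (N + 1) * (((1 / 2 : ℝ)) ^ k) ^ σ =
      ((2 ^ k) ^ σ * Real.exp (-1))⁻¹ * (N + 1) := by
    rw [one_div, inv_pow, Real.inv_rpow (by positivity), Real.exp_neg]
    field_simp
  rw [h4, ENNReal.ofReal_mul (by positivity), ENNReal.ofReal_inv_of_pos (by positivity),
    ← ENNReal.mul_le_iff_le_inv (by simp; positivity) ENNReal.ofReal_ne_top]
  refine h3.trans ?_
  rw [← ENNReal.ofReal_natCast]
  exact ENNReal.ofReal_le_ofReal (by linarith)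

/-- Almost every projection of the support of a Frostman measure has positive Hausdorff measure. -/
theorem ae_hausdorffMeasure_image_ne_zero (hc : 0 < c)
    (hG : lam (grassmannian n (m + 1))ᶜ = 0)
    (hlam : ∀ P ∈ grassmannian n (m + 1), ∀ r : ℝ, 0 < r →
      lam (closedBall P r) ≤ ENNReal.ofReal (c * r ^ β))
    {τ : ℝ} (hτ : τ = β - m * (n - (m + 1) : ℕ)) (hs : 0 ≤ s) (hC : 0 ≤ C)
    (hμ : ∀ x, ∀ r : ℝ, 0 < r → μ (ball x r) ≤ ENNReal.ofReal (C * r ^ s))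
    {R : ℝ} (hR : ∀ᵐ z ∂(differenceMeasure μ), ‖z‖ ≤ R) {a σ : ℝ} (ha : 0 ≤ a)
    (hp : 0 ≤ a + τ) (hnp : n - s < a + τ) (hσ : 0 < σ) (hσa : σ < (m + 1 : ℕ) - a)
    {A : Set (EuclideanSpace ℝ (Fin n))} (hA : μ Aᶜ = 0) :
    ∀ᵐ (P : EuclideanSpace ℝ (Fin n) →L[ℝ] EuclideanSpace ℝ (Fin n)) ∂lam, μH[σ] (⇑P '' A) ≠ 0 := by
  obtain ⟨M, hM, hMr⟩ :=
    exists_lintegral_projection_gaussian_le hc hG hlam hτ hs hC hμ hR ha hp hnp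
  have : ProperSpace (EuclideanSpace ℝ (Fin n) →L[ℝ] EuclideanSpace ℝ (Fin n)) :=
    FiniteDimensional.proper ℝ _
  set ρ : ℝ := (m + 1 : ℕ) - a
  have hmeas : ∀ k : ℕ, Measurable fun P : EuclideanSpace ℝ (Fin n) →L[ℝ]
      EuclideanSpace ℝ (Fin n) => ∫⁻ z, ENNReal.ofReal
        (Real.exp (-(‖P z‖ ^ 2 / ((1 / 2) ^ k) ^ 2))) ∂(differenceMeasure μ) := fun k =>
    Measurable.lintegral_prod_right' (f := fun q : (EuclideanSpace ℝ (Fin n) →L[ℝ]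
      EuclideanSpace ℝ (Fin n)) × EuclideanSpace ℝ (Fin n) => ENNReal.ofReal
        (Real.exp (-(‖q.1 q.2‖ ^ 2 / ((1 / 2) ^ k) ^ 2))))
      (ENNReal.measurable_ofReal.comp (Continuous.measurable (by fun_prop)))
  have hq : (1 / 2 : ℝ) ^ (ρ - σ) < 1 :=
    Real.rpow_lt_one (by norm_num) (by norm_num) (by linarith)
  have hfin : ∫⁻ P, ∑' k : ℕ, ENNReal.ofReal ((2 ^ k) ^ σ) * ∫⁻ z, ENNReal.ofReal
      (Real.exp (-(‖P z‖ ^ 2 / ((1 / 2) ^ k) ^ 2))) ∂(differenceMeasure μ) ∂lam ≠ ⊤ := by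
    rw [lintegral_tsum fun k => ((hmeas k).const_mul _).aemeasurable]
    refine ne_top_of_le_ne_top (b := ENNReal.ofReal (∑' k : ℕ, ((1 / 2 : ℝ) ^ (ρ - σ)) ^ k) * M)
      (ENNReal.mul_ne_top ENNReal.ofReal_ne_top hM) ?_
    rw [ENNReal.ofReal_tsum_of_nonneg (fun k => by positivity)
      (summable_geometric_of_lt_one (by positivity) hq), ← ENNReal.tsum_mul_right]
    refine ENNReal.tsum_le_tsum fun k => ?_
    rw [lintegral_const_mul _ (hmeas k)]
    refine (mul_le_mul_right (hMr ((1 / 2) ^ k) (by positivity)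
      (pow_le_one₀ (by norm_num) (by norm_num))) _).trans (le_of_eq ?_)
    rw [← mul_assoc, ← ENNReal.ofReal_mul (by positivity)]
    congr 2
    have h2 : ((2 : ℝ) ^ k) ^ σ = ((1 / 2) ^ k) ^ (-σ) := by
      rw [Real.rpow_neg (by positivity), ← Real.inv_rpow (by positivity)]
      simp
    rw [h2, ← Real.rpow_add (by positivity), ← Real.rpow_natCast, ← Real.rpow_natCast,
      ← Real.rpow_mul (by norm_num), ← Real.rpow_mul (by norm_num)]
    ring_nf
  filter_upwards [ae_lt_top (Measurable.tsum fun k => (hmeas k).const_mul _) hfin] with P hP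
  exact hausdorffMeasure_image_ne_zero_of_energy hσ hP.ne hA

end

/-- Peres–Schlag exceptional-set estimate for orthogonal projections onto
`ℓ`-dimensional subspaces of `ℝⁿ`.  The Grassmannian `𝒢(n,ℓ)` is identified with the set of
orthogonal projections (idempotent, self-adjoint continuous linear maps of rank `ℓ`), a subset of
the bounded operators on `ℝⁿ` with the operator-norm metric. -/
theorem stmt0 (n ℓ : ℕ) (hn : 2 ≤ n) (hℓ1 : 1 ≤ ℓ) (hℓn : ℓ < n)
    (α σ β : ℝ) (hα0 : 0 < α) (hαn : α < n) (hσ0 : 0 < σ) (hσℓ : σ < ℓ)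
    (hβ1 : (ℓ : ℝ) * ((n : ℝ) - ℓ) + σ - α < β) (hβ2 : β < (ℓ : ℝ) * ((n : ℝ) - ℓ))
    (G : Set (EuclideanSpace ℝ (Fin n) →L[ℝ] EuclideanSpace ℝ (Fin n)))
    (hG : G = {P | P.comp P = P ∧ (∀ u v, ⟪P u, v⟫_ℝ = ⟪u, P v⟫_ℝ) ∧
      Module.finrank ℝ (LinearMap.range P.toLinearMap) = ℓ})
    (lam : Measure (EuclideanSpace ℝ (Fin n) →L[ℝ] EuclideanSpace ℝ (Fin n)))
    (hlamG : lam Gᶜ = 0)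
    (c : ℝ) (hc : 0 < c)
    (hlamβ : ∀ P ∈ G, ∀ r : ℝ, 0 < r →
      lam (closedBall P r) ≤ ENNReal.ofReal (c * r ^ β))
    (E : Set (EuclideanSpace ℝ (Fin n))) (hE : MeasurableSet E)
    (hdimE : ENNReal.ofReal α ≤ dimH E) :
    ∀ᵐ (P : EuclideanSpace ℝ (Fin n) →L[ℝ] EuclideanSpace ℝ (Fin n)) ∂lam, ENNReal.ofReal σ ≤ dimH (⇑P '' E) := by
  obtain ⟨m, rfl⟩ : ∃ m, ℓ = m + 1 := ⟨ℓ - 1, by omega⟩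
  subst hG
  set τ : ℝ := β - m * (n - (m + 1) : ℕ) with hτ
  have hcast : ((n - (m + 1) : ℕ) : ℝ) = n - (m + 1) := by
    rw [Nat.cast_sub hℓn.le]; push_cast; ring
  push_cast at hβ1 hσℓ
  obtain ⟨s, hs, hsα⟩ := exists_between
    (max_lt hα0 (show (m + 1) * ((n : ℝ) - (m + 1)) + σ - β < α by linarith))
  obtain ⟨hs0, hs1⟩ := max_lt_iff.1 hs
  obtain ⟨a, ha, haσ⟩ := exists_between (max_lt (show 0 < (m + 1 : ℝ) - σ by linarith)
    (show n - s - τ < (m + 1 : ℝ) - σ by rw [hτ, hcast]; linarith))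
  obtain ⟨ha0, ha1⟩ := max_lt_iff.1 ha
  have hHs : μH[s] E ≠ 0 := by
    have h1 : ((s.toNNReal : NNReal) : ℝ≥0∞) < dimH E :=
      lt_of_lt_of_le ((ENNReal.ofReal_lt_ofReal_iff hα0).2 hsα) hdimE
    have h2 := hausdorffMeasure_of_lt_dimH h1
    rw [Real.coe_toNNReal s hs0.le] at h2
    rw [h2]
    exact ENNReal.top_ne_zero
  obtain ⟨K, hKE, -, hKd, μ, hμ, hμK, C, hC, hball⟩ := exists_frostman_measure hs0 hE hHs
  have hKae : ∀ᵐ x ∂μ, x ∈ K := mem_ae_iff.2 hμK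
  have hR : ∀ᵐ z ∂(differenceMeasure μ), ‖z‖ ≤ √n := by
    rw [differenceMeasure, ae_map_iff (by fun_prop) (measurableSet_le (by fun_prop) (by fun_prop))]
    filter_upwards [Measure.quasiMeasurePreserving_fst.ae hKae,
      Measure.quasiMeasurePreserving_snd.ae hKae] with p h1 h2
    rw [← dist_eq_norm]
    exact hKd _ h1 _ h2
  have hEμ : μ Eᶜ = 0 := measure_mono_null (compl_subset_compl.2 hKE) hμK
  filter_upwards [ae_hausdorffMeasure_image_ne_zero hc hlamG hlamβ hτ hs0.le hC.le hball hR ha0.le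
    (by linarith) (by linarith) hσ0 (by push_cast; linarith) hEμ] with P hP
  refine le_dimH_of_hausdorffMeasure_ne_zero (d := σ.toNNReal) ?_
  rwa [Real.coe_toNNReal σ hσ0.le]
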